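/- arXiv:1010.3527 — 5 statements merged into one kernel-verified Lean document; each statement's English description precedes it below -/
import Mathlib

section
/- Quasi all f ∈ C(𝕋) have the property that for quasi all compact nonempty sets E ∈ 𝒦(𝕋), the restrictions {sₙf|_E : n ∈ ℕ} form a dense subset of C(E) with the sup norm; that is, (sₙf) is uniformly universal on quasi all E ∈ 𝒦(𝕋). -/
open MeasureTheory Complex Filter Topology Set TopologicalSpace

noncomputable section

instance : Fact (0 < 2 * Real.pi) := ⟨by positivity⟩

/-- The unit circle ℝ/2πℤ. -/
abbrev UnitCircle := AddCircle (2 * Real.pi)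

/-- The n-th partial sum of the Fourier series of `f`. -/
noncomputable def partialSum (n : ℕ) (f : UnitCircle → ℂ) : C(UnitCircle, ℂ) :=
  ∑ k ∈ Finset.Icc (-(n : ℤ)) (n : ℤ), fourierCoeff f k • fourier k

/-! ### Basic facts on partial sums -/

lemma integrable_cm (f : C(UnitCircle, ℂ)) : Integrable (⇑f) (@AddCircle.haarAddCircle (2 * Real.pi) _) :=
  f.continuous.integrable_of_hasCompactSupport (HasCompactSupport.of_compactSpace _)

def coeffL (k : ℤ) : C(UnitCircle, ℂ) →L[ℂ] ℂ :=
  LinearMap.mkContinuous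
    { toFun := fun f => fourierCoeff (⇑f) k
      map_add' := fun f g => by
        have := fourierCoeff.add (integrable_cm f) (integrable_cm g)
        simpa using congrFun this k
      map_smul' := fun c f => by
        simpa using fourierCoeff.const_smul (⇑f) c k } 1 (by
      intro f
      simp only [LinearMap.coe_mk, AddHom.coe_mk, one_mul, fourierCoeff]
      refine (norm_integral_le_of_norm_le_const (C := ‖f‖) (ae_of_all _ fun t => ?_)).trans ?_
      · rw [norm_smul]
        have h1 := (fourier (T := 2 * Real.pi) (-k)).norm_coe_le_norm t
        rw [fourier_norm] at h1
        have h2 := f.norm_coe_le_norm t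
        nlinarith [norm_nonneg (f t)]
      · simp)

lemma coeffL_apply (k : ℤ) (f : C(UnitCircle, ℂ)) : coeffL k f = fourierCoeff (⇑f) k := rfl

def sumL (n : ℕ) : C(UnitCircle, ℂ) →L[ℂ] C(UnitCircle, ℂ) :=
  ∑ k ∈ Finset.Icc (-(n : ℤ)) (n : ℤ), (coeffL k).smulRight (fourier k)

lemma sumL_apply (n : ℕ) (f : C(UnitCircle, ℂ)) : sumL n f = partialSum n ⇑f := by
  simp [sumL, partialSum, coeffL_apply]

def evL (n : ℕ) (x : UnitCircle) : C(UnitCircle, ℂ) →L[ℂ] ℂ :=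
  (ContinuousMap.evalCLM ℂ x).comp (sumL n)

lemma evL_apply (n : ℕ) (x : UnitCircle) (f : C(UnitCircle, ℂ)) :
    evL n x f = partialSum n (⇑f) x := by
  simp [evL, sumL_apply]

lemma evL_eq (n : ℕ) (x : UnitCircle) (f : C(UnitCircle, ℂ)) :
    evL n x f = ∑ k ∈ Finset.Icc (-(n : ℤ)) (n : ℤ), fourierCoeff (⇑f) k * fourier k x := by
  simp [evL_apply, partialSum, ContinuousMap.sum_apply, -fourier_apply]

/-- translate -/
def tr (a : UnitCircle) (f : C(UnitCircle, ℂ)) : C(UnitCircle, ℂ) :=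
  f.comp ⟨fun x => x - a, by fun_prop⟩

lemma tr_apply (a : UnitCircle) (f : C(UnitCircle, ℂ)) (x : UnitCircle) :
    tr a f x = f (x - a) := rfl

lemma fourier_add_arg (k : ℤ) (x y : UnitCircle) :
    fourier k (x + y) = fourier k x * fourier k y := by
  simp [fourier_apply, smul_add, AddCircle.toCircle_add]

lemma coeff_tr (a : UnitCircle) (f : C(UnitCircle, ℂ)) (k : ℤ) :
    fourierCoeff (⇑(tr a f)) k = fourier (-k) a * fourierCoeff (⇑f) k := by
  unfold fourierCoeff
  rw [← integral_const_mul, 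
    ← integral_sub_right_eq_self (fun t => fourier (-k) a * (fourier (-k) t • f t)) a]
  congr 1
  ext t
  have : t = a + (t - a) := by abel
  rw [tr_apply]
  conv_lhs => rw [this, fourier_add_arg]
  simp [-fourier_apply, mul_assoc]

lemma evL_tr (n : ℕ) (a x : UnitCircle) (f : C(UnitCircle, ℂ)) :
    evL n x (tr a f) = evL n (x - a) f := by
  rw [evL_eq, evL_eq]
  refine Finset.sum_congr rfl fun k _ => ?_
  rw [coeff_tr, sub_eq_add_neg, fourier_add_arg]
  have : fourier k (-a) = fourier (-k) a := by simp [fourier_apply]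
  rw [this]; ring

lemma norm_tr_le (a : UnitCircle) (f : C(UnitCircle, ℂ)) : ‖tr a f‖ ≤ ‖f‖ := by
  rw [ContinuousMap.norm_le _ (norm_nonneg _)]
  intro x
  exact f.norm_coe_le_norm _

/-! ### Riemann-Lebesgue and localization -/

lemma coeff_tendsto (f : C(UnitCircle, ℂ)) :
    Tendsto (fun k : ℤ => fourierCoeff (⇑f) k) cofinite (𝓝 0) := by
  have h := (hasSum_sq_fourierCoeff
    (ContinuousMap.toLp (E := ℂ) 2 AddCircle.haarAddCircle ℂ f)).summable.tendsto_cofinite_zero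
  simp only [fourierCoeff_toLp] at h
  rw [tendsto_zero_iff_norm_tendsto_zero]
  have h2 := (Real.continuous_sqrt.tendsto 0).comp h
  simpa [Function.comp_def, Real.sqrt_sq] using h2

lemma coeff_shift (q : C(UnitCircle, ℂ)) (k : ℤ) :
    fourierCoeff (⇑(fourier 1 * q : C(UnitCircle, ℂ))) k = fourierCoeff (⇑q) (k - 1) := by
  unfold fourierCoeff
  congr 1
  ext t
  have : -(k - 1) = -k + 1 := by ring
  rw [this, fourier_add]
  simp only [ContinuousMap.mul_apply, smul_eq_mul, mul_assoc]

lemma tele (a : ℤ → ℂ) (n : ℕ) :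
    ∑ k ∈ Finset.Icc (-(n : ℤ)) (n : ℤ), (a (k - 1) - a k) = a (-(n : ℤ) - 1) - a n := by
  induction n with
  | zero => simp
  | succ n ih =>
    have : Finset.Icc (-((n + 1 : ℕ) : ℤ)) ((n + 1 : ℕ) : ℤ) =
        insert (-((n + 1 : ℕ) : ℤ)) (insert ((n + 1 : ℕ) : ℤ) (Finset.Icc (-(n : ℤ)) (n : ℤ))) := by
      ext k; simp only [Finset.mem_Icc, Finset.mem_insert]; push_cast; omega
    rw [this, Finset.sum_insert, Finset.sum_insert, ih]
    · push_cast
      have e1 : -((n : ℤ) + 1) = -(n : ℤ) - 1 := by ring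
      have e2 : (n : ℤ) + 1 - 1 = n := by ring
      rw [e1, e2]; ring
    · simp
    · simp only [Finset.mem_Icc, Finset.mem_insert]; push_cast; omega

lemma local0 (f : C(UnitCircle, ℂ)) (hf : ∀ᶠ x in 𝓝 (0 : UnitCircle), f x = 0) :
    Tendsto (fun n : ℕ => evL n 0 f) atTop (𝓝 0) := by
  have hne : ∀ x : UnitCircle, x ≠ 0 → (fourier 1 x : ℂ) - 1 ≠ 0 := by
    intro x hx h
    apply hx
    apply AddCircle.injective_toCircle (T := 2 * Real.pi) (by positivity)
    rw [fourier_one, sub_eq_zero] at h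
    rw [AddCircle.toCircle_zero]
    exact Circle.ext h
  have hc : Continuous fun x : UnitCircle => f x / (fourier 1 x - 1) := by
    rw [continuous_iff_continuousAt]
    intro x
    by_cases hx : x = 0
    · subst hx
      have : (fun x : UnitCircle => f x / (fourier 1 x - 1)) =ᶠ[𝓝 0] fun _ => 0 := by
        filter_upwards [hf] with x hx
        simp [hx]
      exact continuousAt_const.congr this.symm
    · exact f.continuous.continuousAt.div
        (((map_continuous (fourier 1)).sub continuous_const).continuousAt) (hne x hx)
  set q : C(UnitCircle, ℂ) := ⟨_, hc⟩ with hq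
  have hfq : f = fourier 1 * q - q := by
    ext x
    have : (fourier 1 * q - q : C(UnitCircle, ℂ)) x = (fourier 1 x - 1) * (f x / (fourier 1 x - 1)) := by
      simp only [ContinuousMap.sub_apply, ContinuousMap.mul_apply, hq, ContinuousMap.coe_mk]
      ring
    rw [this]
    by_cases hx : x = 0
    · subst hx; simp [hf.self_of_nhds]
    · rw [mul_div_cancel₀ _ (hne x hx)]
  have hcoef : ∀ k, fourierCoeff (⇑f) k = fourierCoeff (⇑q) (k - 1) - fourierCoeff (⇑q) k := by
    intro k
    rw [← coeff_shift, ← coeffL_apply, ← coeffL_apply, ← coeffL_apply, ← map_sub, ← hfq]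
  have hev : ∀ n : ℕ, evL n 0 f = fourierCoeff (⇑q) (-(n : ℤ) - 1) - fourierCoeff (⇑q) n := by
    intro n
    rw [evL_eq, ← tele]
    refine Finset.sum_congr rfl fun k _ => ?_
    rw [fourier_eval_zero, mul_one, hcoef]
  simp only [hev]
  have h := coeff_tendsto q
  have t1 : Tendsto (fun n : ℕ => (-(n : ℤ) - 1)) atTop cofinite := by
    rw [← Nat.cofinite_eq_atTop]
    exact Function.Injective.tendsto_cofinite fun a b h => by simpa using h
  have t2 : Tendsto (fun n : ℕ => (n : ℤ)) atTop cofinite := by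
    rw [← Nat.cofinite_eq_atTop]
    exact Function.Injective.tendsto_cofinite fun a b h => by simpa using h
  simpa using (h.comp t1).sub (h.comp t2)

lemma local_at (f : C(UnitCircle, ℂ)) (y : UnitCircle) (hf : ∀ᶠ x in 𝓝 y, f x = 0) :
    Tendsto (fun n : ℕ => evL n y f) atTop (𝓝 0) := by
  have := local0 (tr (-y) f) (by
    have : Tendsto (fun x : UnitCircle => x - (-y)) (𝓝 0) (𝓝 y) := by
      have : Continuous (fun x : UnitCircle => x - (-y)) := by fun_prop
      simpa using this.tendsto 0
    exact this.eventually hf)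
  simpa [evL_tr] using this

/-! ### Unboundedness -/

lemma evL_fourier (n : ℕ) (m : ℤ) :
    evL n 0 (fourier m) = if m ∈ Finset.Icc (-(n : ℤ)) (n : ℤ) then 1 else 0 := by
  rw [evL_eq]
  simp only [fourier_eval_zero, mul_one, fourierCoeff_fourier, Pi.single_apply]
  rw [Finset.sum_ite_eq']

lemma big_poly (M : ℝ) (hM : 0 ≤ M) :
    ∃ (N : ℕ) (Q : C(UnitCircle, ℂ)), ‖Q‖ ≤ 5 ∧ M ≤ ‖evL N 0 Q‖ := by
  set r : ℝ := 1 - Real.exp (-(M + 1)) with hr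
  have hr1 : r < 1 := by rw [hr]; linarith [Real.exp_pos (-(M+1))]
  have hr0 : 0 ≤ r := by
    have : Real.exp (-(M+1)) ≤ 1 := Real.exp_le_one_iff.2 (by linarith)
    rw [hr]; linarith
  have hs := (Real.hasSum_pow_div_log_of_abs_lt_one (x := r) (by rw [abs_of_nonneg hr0]; exact hr1)).tendsto_sum_nat
  have hlog : -Real.log (1 - r) = M + 1 := by rw [hr]; simp
  rw [hlog] at hs
  have e1 : ∀ᶠ N : ℕ in atTop, M < ∑ i ∈ Finset.range N, r ^ (i + 1) / ((i : ℝ) + 1) :=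
    hs.eventually_const_lt (by linarith)
  have e2 : ∀ᶠ N : ℕ in atTop, r ^ (N + 1) * (1 - r)⁻¹ / ((N : ℝ) + 1) < 1 / 4 := by
    have t1 : Tendsto (fun N : ℕ => (1 - r)⁻¹ / ((N : ℝ) + 1)) atTop (𝓝 0) :=
      tendsto_const_nhds.div_atTop (tendsto_atTop_add_const_right _ _ tendsto_natCast_atTop_atTop)
    filter_upwards [t1.eventually_lt_const (show (0 : ℝ) < 1 / 4 by norm_num)] with N hN
    refine lt_of_le_of_lt ?_ hN
    have : r ^ (N + 1) ≤ 1 := pow_le_one₀ hr0 hr1.le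
    have h3 : 0 ≤ (1 - r)⁻¹ := inv_nonneg.2 (by linarith)
    gcongr
    nlinarith
  obtain ⟨N, h1, h2⟩ := (e1.and e2).exists
  refine ⟨N, ∑ k ∈ Finset.range (N + 1), ((r : ℂ) ^ k / k) •
    (fourier ((N : ℤ) - k) - fourier ((N : ℤ) + k)), ?_, ?_⟩
  · rw [ContinuousMap.norm_le _ (by norm_num)]
    intro x
    set w : ℂ := fourier 1 x with hw
    set z : ℂ := r * w with hz
    have hwn : ‖w‖ = 1 := by rw [hw, fourier_one]; exact Circle.norm_coe _
    have hzn : ‖z‖ = r := by rw [hz, norm_mul, hwn, mul_one, norm_real, Real.norm_of_nonneg hr0]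
    have hfk : ∀ k : ℕ, fourier (k : ℤ) x = w ^ k := by
      intro k
      induction k with
      | zero => simp
      | succ k ih => push_cast; rw [fourier_add, ih, pow_succ]
    set W : ℂ := ∑ k ∈ Finset.range (N + 1), z ^ k / k with hW
    have hWT : W = - logTaylor (N + 1) (-z) := by
      rw [hW, logTaylor, ← Finset.sum_neg_distrib]
      refine Finset.sum_congr rfl fun k _ => ?_
      rw [neg_pow z k, pow_succ]
      have : ((-1 : ℂ) ^ k) * (-1) ^ k = 1 := by rw [← mul_pow]; simp
      linear_combination (-(z ^ k / k)) * this
    have hval : (∑ k ∈ Finset.range (N + 1), ((r : ℂ) ^ k / k) •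
        (fourier ((N : ℤ) - k) - fourier ((N : ℤ) + k)) : C(UnitCircle, ℂ)) x =
        fourier (N : ℤ) x * ((starRingEnd ℂ) W - W) := by
      rw [ContinuousMap.sum_apply, hW, map_sum, ← Finset.sum_sub_distrib, Finset.mul_sum]
      refine Finset.sum_congr rfl fun k _ => ?_
      rw [ContinuousMap.smul_apply, ContinuousMap.sub_apply, sub_eq_add_neg (N : ℤ), fourier_add,
        fourier_add, fourier_neg, hfk k, hz]
      simp only [map_div₀, map_pow, map_mul, conj_ofReal, map_natCast, smul_eq_mul]
      ring
    rw [hval, norm_mul, hfk, norm_pow, hwn, one_pow, one_mul]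
    have hb := norm_log_sub_logTaylor_le N (z := -z) (by rw [norm_neg, hzn]; exact hr1)
    rw [norm_neg, hzn] at hb
    have hbW : ‖log (1 + -z) + W‖ < 1 / 4 := by
      rw [hWT, ← sub_eq_add_neg]; exact hb.trans_lt h2
    have hre : 0 ≤ (1 + -z).re := by
      have := (abs_le.1 (abs_re_le_norm z)).2
      simp only [add_re, one_re, neg_re]; linarith
    have harg := abs_arg_le_pi_div_two_iff.2 hre
    have him : |W.im| ≤ Real.pi / 2 + 1 / 4 := by
      have a1 := abs_im_le_norm (log (1 + -z) + W)
      rw [add_im, log_im] at a1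
      rw [abs_le] at *
      constructor <;> linarith [a1.1, a1.2, harg.1, harg.2]
    have : (starRingEnd ℂ) W - W = -(2 * W.im * I) := by
      apply Complex.ext <;> simp
      ring
    rw [this]
    simp only [norm_neg, norm_mul, norm_I, mul_one, norm_real, Real.norm_eq_abs, Complex.norm_ofNat]
    linarith [Real.pi_lt_d2]
  · have : evL N 0 (∑ k ∈ Finset.range (N + 1), ((r : ℂ) ^ k / k) •
        (fourier ((N : ℤ) - k) - fourier ((N : ℤ) + k))) =
        ((∑ i ∈ Finset.range N, r ^ (i + 1) / ((i : ℝ) + 1) : ℝ) : ℂ) := by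
      rw [map_sum, Finset.sum_range_succ']
      simp only [map_smul, map_sub, evL_fourier]
      push_cast
      simp only [div_zero, zero_smul, add_zero]
      refine Finset.sum_congr rfl fun k hk => ?_
      rw [Finset.mem_range] at hk
      rw [if_pos (by simp only [Finset.mem_Icc]; omega),
        if_neg (by simp only [Finset.mem_Icc]; omega)]
      simp
    rw [this, norm_real, Real.norm_eq_abs]
    exact h1.le.trans (le_abs_self _)

lemma exists_unbdd : ∃ u : C(UnitCircle, ℂ), ∀ C : ℝ, ∃ n, C < ‖evL n 0 u‖ := by
  by_contra! h
  obtain ⟨C, hC⟩ := banach_steinhaus (g := fun n => evL n 0) h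
  have hC0 : 0 ≤ C := (norm_nonneg _).trans (hC 0)
  obtain ⟨N, Q, h5, hQ⟩ := big_poly (C * 5 + 1) (by positivity)
  have := (evL N 0).le_opNorm Q
  have h2 := hC N
  have : ‖evL N 0‖ * ‖Q‖ ≤ C * 5 := by gcongr
  linarith

/-- A localized function with unbounded partial sums at zero. -/
lemma exists_local (δ : ℝ) (hδ : 0 < δ) : ∃ h : C(UnitCircle, ℂ),
    (∀ C : ℝ, ∀ n₀ : ℕ, ∃ n ≥ n₀, C < ‖evL n 0 h‖) ∧ ∀ x : UnitCircle, δ ≤ dist x 0 → h x = 0 := by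
  obtain ⟨u, hu⟩ := exists_unbdd
  let φ : C(UnitCircle, ℂ) := ⟨fun x => ((max 0 (min 1 (2 - 2 * dist x 0 / δ)) : ℝ) : ℂ), by fun_prop⟩
  refine ⟨φ * u, ?_, ?_⟩
  · have ht : Tendsto (fun n : ℕ => evL n 0 (u - φ * u)) atTop (𝓝 0) := by
      apply local0
      filter_upwards [Metric.ball_mem_nhds (0 : UnitCircle) (half_pos hδ)] with x hx
      rw [Metric.mem_ball] at hx
      have : 2 * dist x 0 / δ ≤ 1 := by rw [div_le_one hδ]; linarith
      have h1 : φ x = 1 := by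
        show ((max 0 (min 1 (2 - 2 * dist x 0 / δ)) : ℝ) : ℂ) = 1
        rw [min_eq_left (by linarith)]; simp
      simp [h1]
    obtain ⟨B, hB⟩ := (Metric.isBounded_range_of_tendsto _ ht).exists_norm_le
    intro C n₀
    obtain ⟨n, hn⟩ := hu (|C| + B + ∑ i ∈ Finset.range n₀, ‖evL i 0 u‖)
    have hB0 : 0 ≤ B := (norm_nonneg _).trans (hB _ ⟨0, rfl⟩)
    have hs : 0 ≤ ∑ i ∈ Finset.range n₀, ‖evL i 0 u‖ := Finset.sum_nonneg fun _ _ => norm_nonneg _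
    refine ⟨n, ?_, ?_⟩
    · by_contra! hlt
      have := Finset.single_le_sum (f := fun i => ‖evL i 0 u‖) (fun _ _ => norm_nonneg _)
        (Finset.mem_range.2 hlt)
      linarith [abs_nonneg C]
    · have h1 := hB _ ⟨n, rfl⟩
      simp only [map_sub] at h1
      have h2 := norm_sub_norm_le (evL n 0 u) (evL n 0 (φ * u))
      linarith [le_abs_self C]
  · intro x hx
    have : 2 ≤ 2 * dist x 0 / δ := by rw [le_div_iff₀ hδ]; linarith
    have h1 : φ x = 0 := by
      show ((max 0 (min 1 (2 - 2 * dist x 0 / δ)) : ℝ) : ℂ) = 0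
      rw [max_eq_left ((min_le_right _ _).trans (by linarith))]; simp
    simp [h1]

/-! ### Density -/

lemma trig_stable (p : C(UnitCircle, ℂ))
    (hp : p ∈ Submodule.span ℂ (Set.range (@fourier (2 * Real.pi)))) :
    ∃ m : ℕ, ∀ n ≥ m, sumL n p = p := by
  induction hp using Submodule.span_induction with
  | mem x hx =>
    obtain ⟨k, rfl⟩ := hx
    refine ⟨k.natAbs, fun n hn => ?_⟩
    rw [sumL_apply, partialSum]
    simp only [fourierCoeff_fourier, Pi.single_apply, ite_smul, one_smul, zero_smul]
    rw [Finset.sum_ite_eq', if_pos]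
    rw [Finset.mem_Icc]; omega
  | zero => exact ⟨0, fun n _ => map_zero _⟩
  | add x y _ _ hx hy =>
    obtain ⟨a, ha⟩ := hx
    obtain ⟨b, hb⟩ := hy
    refine ⟨max a b, fun n hn => ?_⟩
    rw [map_add, ha n ((le_max_left _ _).trans hn), hb n ((le_max_right _ _).trans hn)]
  | smul c x _ hx =>
    obtain ⟨a, ha⟩ := hx
    exact ⟨a, fun n hn => by rw [map_smul, ha n hn]⟩

lemma exists_trig (f : C(UnitCircle, ℂ)) (δ : ℝ) (hδ : 0 < δ) :
    ∃ p : C(UnitCircle, ℂ), dist p f < δ ∧ ∃ m : ℕ, ∀ n ≥ m, sumL n p = p := by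
  have h : f ∈ (Submodule.span ℂ (Set.range (@fourier (2 * Real.pi)))).topologicalClosure := by
    rw [span_fourier_closure_eq_top]; trivial
  rw [← SetLike.mem_coe, Submodule.topologicalClosure_coe, Metric.mem_closure_iff] at h
  obtain ⟨p, hp, hd⟩ := h δ hδ
  exact ⟨p, by rwa [dist_comm], trig_stable p hp⟩

lemma finset_sep (F : Finset UnitCircle) :
    ∃ d > 0, ∀ x ∈ F, ∀ y ∈ F, x ≠ y → d ≤ dist y x := by
  have : ∀ᶠ d in 𝓝[>] (0 : ℝ), ∀ x ∈ F, ∀ y ∈ F, x ≠ y → d ≤ dist y x := by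
    rw [Filter.eventually_all_finset]
    intro x _
    rw [Filter.eventually_all_finset]
    intro y _
    by_cases hxy : x = y
    · simp [hxy]
    · filter_upwards [Ioo_mem_nhdsGT (dist_pos.2 (Ne.symm hxy))] with d hd _
      exact hd.2.le
  obtain ⟨d, hd, hd0⟩ := (this.and self_mem_nhdsWithin).exists
  exact ⟨d, hd0, hd⟩

lemma dense_U (F : Finset UnitCircle) (g : C(UnitCircle, ℂ)) (ε : ℝ) (hε : 0 < ε) :
    Dense {f : C(UnitCircle, ℂ) | ∃ n, ∀ x ∈ F, ‖evL n x f - g x‖ < ε} := by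
  classical
  rw [Metric.dense_iff]
  intro f₀ δ hδ
  obtain ⟨p, hpf, m, hm⟩ := exists_trig f₀ (δ / 2) (half_pos hδ)
  obtain ⟨d, hd0, hd⟩ := finset_sep F
  obtain ⟨h, hbig, hloc⟩ := exists_local (d / 2) (half_pos hd0)
  have hev : ∀ᶠ n : ℕ in atTop, ∀ x ∈ F, ∀ y ∈ F, x ≠ y → ‖evL n (y - x) h‖ ≤ 1 := by
    rw [Filter.eventually_all_finset]
    intro x hx
    rw [Filter.eventually_all_finset]
    intro y hy
    by_cases hxy : x = y
    · simp [hxy]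
    · have ht : Tendsto (fun n : ℕ => evL n (y - x) h) atTop (𝓝 0) := by
        apply local_at
        have ho : IsOpen {z : UnitCircle | d / 2 < dist z 0} :=
          isOpen_lt continuous_const (by fun_prop)
        have hmem : y - x ∈ {z : UnitCircle | d / 2 < dist z 0} := by
          have := hd x hx y hy hxy
          rw [mem_ofPred_eq, dist_zero_right, ← dist_eq_norm]
          linarith
        filter_upwards [ho.mem_nhds hmem] with z hz
        exact hloc z (le_of_lt hz)
      have := ht.norm.eventually_lt_const (show ‖(0 : ℂ)‖ < 1 by simp)
      filter_upwards [this] with n hn _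
      exact hn.le
  obtain ⟨n₁, hn₁⟩ := eventually_atTop.1 hev
  set K : ℝ := ∑ x ∈ F, ‖g x - p x‖ with hK
  have hK0 : 0 ≤ K := Finset.sum_nonneg fun _ _ => norm_nonneg _
  set η : ℝ := min (δ / 2) ε with hη
  have hη0 : 0 < η := lt_min (half_pos hδ) hε
  obtain ⟨n, hn, hA⟩ := hbig (K * (‖h‖ + 1) / η) (max m n₁)
  set A : ℂ := evL n 0 h with hAdef
  have hA0 : 0 < ‖A‖ := lt_of_le_of_lt (by positivity) hA
  have hAne : A ≠ 0 := norm_pos_iff.1 hA0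
  rw [div_lt_iff₀ hη0] at hA
  have hKA : K / ‖A‖ < ε := by
    rw [div_lt_iff₀ hA0]
    have : η ≤ ε := min_le_right _ _
    nlinarith [mul_nonneg hK0 (norm_nonneg h)]
  have hKA2 : K / ‖A‖ * ‖h‖ < δ / 2 := by
    rw [div_mul_eq_mul_div, div_lt_iff₀ hA0]
    have : η ≤ δ / 2 := min_le_left _ _
    nlinarith
  set e : C(UnitCircle, ℂ) := ∑ x ∈ F, ((g x - p x) / A) • tr x h with he
  refine ⟨p + e, ?_, n, ?_⟩
  · rw [Metric.mem_ball]
    have h1 : ‖e‖ ≤ K / ‖A‖ * ‖h‖ := by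
      rw [he, hK, Finset.sum_div, Finset.sum_mul]
      refine (norm_sum_le _ _).trans (Finset.sum_le_sum fun x _ => ?_)
      rw [norm_smul, norm_div]
      gcongr
      exact norm_tr_le x h
    have h2 : dist (p + e) p = ‖e‖ := by rw [dist_eq_norm]; simp
    have := dist_triangle (p + e) p f₀
    linarith
  · intro y hy
    have hp : evL n y p = p y := by
      rw [evL_apply, ← sumL_apply, hm n ((le_max_left _ _).trans hn)]
    have hsum : evL n y (p + e) - g y =
        ∑ x ∈ F.erase y, ((g x - p x) / A) * evL n (y - x) h := by
      rw [map_add, hp, he, map_sum]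
      simp only [map_smul, evL_tr, smul_eq_mul]
      rw [← Finset.add_sum_erase F _ hy, sub_self, ← hAdef, div_mul_cancel₀ _ hAne]
      ring
    rw [hsum]
    refine lt_of_le_of_lt ?_ hKA
    refine (norm_sum_le _ _).trans ?_
    rw [hK, Finset.sum_div]
    refine (Finset.sum_le_sum (g := fun x => ‖g x - p x‖ / ‖A‖) fun x hx => ?_).trans
      (Finset.sum_le_sum_of_subset_of_nonneg (Finset.erase_subset _ _) fun _ _ _ => by positivity)
    rw [norm_mul, norm_div]
    have := hn₁ n ((le_max_right _ _).trans hn) x (Finset.mem_of_mem_erase hx) y hy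
      (Finset.ne_of_mem_erase hx)
    exact mul_le_of_le_one_right (by positivity) this

lemma open_U (F : Finset UnitCircle) (g : C(UnitCircle, ℂ)) (ε : ℝ) :
    IsOpen {f : C(UnitCircle, ℂ) | ∃ n, ∀ x ∈ F, ‖evL n x f - g x‖ < ε} := by
  simp only [ofPred_exists]
  refine isOpen_iUnion fun n => ?_
  simp only [ofPred_forall]
  refine isOpen_biInter_finset fun x _ => ?_
  exact isOpen_lt (by fun_prop) continuous_const

/-- Quasi all `f ∈ C(𝕋)` are such that, for quasi all nonempty compact `E ⊆ 𝕋`, the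
restrictions `{sₙ f |_E : n ∈ ℕ}` are dense in `C(E)`. -/
theorem stmt3 :
    {f : C(UnitCircle, ℂ) |
      {E : NonemptyCompacts UnitCircle |
        Dense (Set.range fun n => (partialSum n ⇑f).restrict (E : Set UnitCircle))} ∈
          residual (NonemptyCompacts UnitCircle)} ∈
      residual C(UnitCircle, ℂ) := by
  obtain ⟨D, hDfin, hDc, hDd⟩ :=
    (NonemptyCompacts.dense_setOfPred_finite (α := UnitCircle)).exists_countable_dense_subset
  let G : ℕ → C(UnitCircle, ℂ) := denseSeq _
  have hG : DenseRange G := denseRange_denseSeq _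
  have hR : (⋂ E ∈ D, ⋂ j : ℕ, ⋂ m : ℕ, {f : C(UnitCircle, ℂ) |
      ∃ n, ∀ x ∈ (E : Set UnitCircle), ‖evL n x f - G j x‖ < 1 / ((m : ℝ) + 1)}) ∈
      residual C(UnitCircle, ℂ) := by
    rw [countable_bInter_mem hDc]
    intro E hE
    rw [countable_iInter_mem]
    intro j
    rw [countable_iInter_mem]
    intro m
    have hfin : (E : Set UnitCircle).Finite := hDfin hE
    have ho := open_U hfin.toFinset (G j) (1 / ((m : ℝ) + 1))
    have hd := dense_U hfin.toFinset (G j) (1 / ((m : ℝ) + 1)) (by positivity)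
    simp only [Set.Finite.mem_toFinset] at ho hd
    exact residual_of_dense_open ho hd
  refine mem_of_superset hR fun f hf => ?_
  simp only [mem_iInter, mem_ofPred_eq] at hf
  have hV : (⋂ j : ℕ, ⋂ m : ℕ, {E : NonemptyCompacts UnitCircle |
      ∃ n, ∀ x ∈ (E : Set UnitCircle), ‖evL n x f - G j x‖ < 1 / ((m : ℝ) + 1)}) ∈
      residual (NonemptyCompacts UnitCircle) := by
    rw [countable_iInter_mem]
    intro j
    rw [countable_iInter_mem]
    intro m
    refine residual_of_dense_open ?_ (hDd.mono fun E hE => hf E hE j m)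
    simp only [ofPred_exists]
    refine isOpen_iUnion fun n => ?_
    refine NonemptyCompacts.isOpen_subsets_of_isOpen
      (U := {x : UnitCircle | ‖evL n x f - G j x‖ < 1 / ((m : ℝ) + 1)}) ?_
    simp only [evL_apply]
    exact isOpen_lt (by fun_prop) continuous_const
  refine mem_of_superset hV fun E hE => ?_
  simp only [mem_iInter, mem_ofPred_eq] at hE
  haveI : CompactSpace (E : Set UnitCircle) := isCompact_iff_compactSpace.1 E.isCompact
  rw [mem_ofPred_eq, Metric.dense_iff]
  intro g ε hε
  obtain ⟨g', hg'⟩ := ContinuousMap.exists_restrict_eq E.isCompact.isClosed g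
  obtain ⟨j, hj⟩ := hG.exists_dist_lt g' (half_pos hε)
  obtain ⟨m, hm⟩ := exists_nat_one_div_lt (half_pos hε)
  obtain ⟨n, hn⟩ := hE j m
  refine ⟨_, ?_, n, rfl⟩
  rw [Metric.mem_ball, ContinuousMap.dist_lt_iff hε]
  intro x
  have h1 := hn x x.2
  rw [evL_apply, ← dist_eq_norm] at h1
  have h2 := (ContinuousMap.dist_apply_le_dist (f := g') (g := G j) (x : UnitCircle)).trans_lt hj
  rw [← hg', ContinuousMap.restrict_apply, ContinuousMap.restrict_apply]
  have := dist_triangle_right (partialSum n (⇑f) (x : UnitCircle)) (g' x) (G j x)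
  linarith
end
end

section
/- For every finite set E ⊆ 𝕋, the set of f ∈ C(𝕋) such that {sₙf|_E : n ∈ ℕ} is dense in ℂ^E is a dense G_δ subset of C(𝕋). -/
open MeasureTheory Complex Filter Topology Set TopologicalSpace

noncomputable section

lemma ps_add (n : ℕ) (f g : C(UnitCircle, ℂ)) :
    partialSum n ⇑(f + g) = partialSum n ⇑f + partialSum n ⇑g := by
  have hf : Integrable (⇑f) (AddCircle.haarAddCircle (T := 2 * Real.pi)) :=
    f.continuous.integrable_of_hasCompactSupport (HasCompactSupport.of_compactSpace _)
  have hg : Integrable (⇑g) (AddCircle.haarAddCircle (T := 2 * Real.pi)) :=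
    g.continuous.integrable_of_hasCompactSupport (HasCompactSupport.of_compactSpace _)
  unfold partialSum
  rw [ContinuousMap.coe_add, fourierCoeff.add hf hg]
  simp only [Pi.add_apply, add_smul, Finset.sum_add_distrib]

lemma ps_smul (n : ℕ) (c : ℂ) (f : C(UnitCircle, ℂ)) :
    partialSum n ⇑(c • f) = c • partialSum n ⇑f := by
  unfold partialSum
  rw [ContinuousMap.coe_smul, Finset.smul_sum]
  refine Finset.sum_congr rfl fun k _ => ?_
  rw [fourierCoeff.const_smul, smul_assoc]

/-- partial sums as a linear map -/
def psL (n : ℕ) : C(UnitCircle, ℂ) →ₗ[ℂ] C(UnitCircle, ℂ) where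
  toFun f := partialSum n ⇑f
  map_add' := ps_add n
  map_smul' := ps_smul n

lemma psL_fourier (n : ℕ) (k : ℤ) :
    psL n (fourier k) = if |k| ≤ (n : ℤ) then fourier k else 0 := by
  change partialSum n _ = _
  unfold partialSum
  rw [fourierCoeff_fourier]
  simp only [Pi.single_apply, ite_smul, one_smul, zero_smul, Finset.sum_ite_eq', Finset.mem_Icc,
    abs_le]

lemma continuous_ps (n : ℕ) (t : UnitCircle) :
    Continuous fun f : C(UnitCircle, ℂ) => partialSum n ⇑f t := by
  have hc (k : ℤ) : Continuous fun f : C(UnitCircle, ℂ) => fourierCoeff ⇑f k := by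
    have : ∀ f : C(UnitCircle, ℂ), fourierCoeff ⇑f k =
        fourierCoeff (ContinuousMap.toLp 2 AddCircle.haarAddCircle ℂ f : UnitCircle → ℂ) k :=
      fun f => (fourierCoeff_toLp f k).symm
    simp only [this, ← fourierBasis_repr]
    have h2 : Continuous fun f : C(UnitCircle, ℂ) =>
      inner ℂ (fourierBasis k) (ContinuousMap.toLp (E := ℂ) 2 AddCircle.haarAddCircle ℂ f) := by
      fun_prop
    simpa only [HilbertBasis.repr_apply_apply] using h2
  unfold partialSum
  simp only [ContinuousMap.coe_sum, Finset.sum_apply, ContinuousMap.coe_smul, Pi.smul_apply]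
  exact continuous_finsetSum _ fun k _ => (hc k).smul continuous_const

lemma eventually_ps (f : C(UnitCircle, ℂ))
    (hf : f ∈ Submodule.span ℂ (range (@fourier (2 * Real.pi)))) :
    ∃ N, ∀ n ≥ N, psL n f = f := by
  induction hf using Submodule.span_induction with
  | mem x hx =>
    obtain ⟨k, rfl⟩ := hx
    refine ⟨k.natAbs, fun n hn => ?_⟩
    rw [psL_fourier, if_pos]
    rw [abs_le]
    omega
  | zero => exact ⟨0, fun n _ => map_zero _⟩
  | add x y _ _ hx hy =>
    obtain ⟨N, hN⟩ := hx
    obtain ⟨M, hM⟩ := hy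
    refine ⟨max N M, fun n hn => ?_⟩
    rw [map_add, hN n (le_trans (le_max_left _ _) hn), hM n (le_trans (le_max_right _ _) hn)]
  | smul c x _ hx =>
    obtain ⟨N, hN⟩ := hx
    exact ⟨N, fun n hn => by rw [map_smul, hN n hn]⟩

/-- the truncated logarithm series is near the logarithm, uniformly on `‖z‖ = r` -/
lemma log_trunc (r : ℝ) (h0 : 0 < r) (h1 : r < 1) :
    ∃ K : ℕ, ∀ z : ℂ, ‖z‖ = r → ‖(∑ j ∈ Finset.range K, z ^ j / j) + log (1 - z)‖ ≤ 1 := by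
  have ht : Tendsto (fun n : ℕ => r ^ n * (1 - r)⁻¹) atTop (𝓝 (0 * (1 - r)⁻¹)) :=
    (tendsto_pow_atTop_nhds_zero_of_lt_one h0.le h1).mul_const _
  rw [zero_mul] at ht
  obtain ⟨n, hn⟩ := (eventually_atTop.1 (ht.eventually (gt_mem_nhds one_pos)))
  refine ⟨n + 1, fun z hz => ?_⟩
  have := norm_log_sub_logTaylor_le n (z := -z) (by rwa [norm_neg, hz])
  rw [norm_neg, hz] at this
  have e : logTaylor (n + 1) (-z) = - ∑ j ∈ Finset.range (n + 1), z ^ j / j := by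
    unfold logTaylor
    rw [← Finset.sum_neg_distrib]
    refine Finset.sum_congr rfl fun j _ => ?_
    rw [neg_pow z, pow_succ]
    have : ((-1 : ℂ) ^ j) * (-1) ^ j = 1 := by rw [← mul_pow]; simp
    linear_combination (- z ^ j / j) * this
  rw [e, sub_neg_eq_add, ← sub_eq_add_neg, add_comm] at this
  refine this.trans ?_
  have h3 := (hn (n + 1) (by omega)).le
  have h4 : 0 ≤ r ^ (n + 1) * (1 - r)⁻¹ := mul_nonneg (by positivity) (inv_nonneg.2 (by linarith))
  exact (div_le_self h4 (by linarith [n.cast_nonneg (α := ℝ)])).trans h3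

lemma fourier_norm_apply (k : ℤ) (t : UnitCircle) : ‖fourier k t‖ = 1 := by
  rw [fourier_apply]; exact Circle.norm_coe _

lemma fourier_nat (j : ℕ) (t : UnitCircle) : fourier (j : ℤ) t = (fourier 1 t) ^ j := by
  induction j with
  | zero => simp
  | succ j ih => rw [Nat.cast_succ, fourier_add, ih, pow_succ]

lemma fourier_negnat (j : ℕ) (t : UnitCircle) : fourier (-(j : ℤ)) t = (fourier (-1) t) ^ j := by
  rw [fourier_neg, fourier_nat, fourier_neg, map_pow]

lemma fourier_ne_one (t : UnitCircle) (h : t ≠ 0) : fourier (-1) t ≠ (1 : ℂ) := by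
  intro h1
  rw [fourier_apply] at h1
  have h2 : AddCircle.toCircle ((-1 : ℤ) • t) = 1 := by
    apply Circle.ext; simpa using h1
  rw [← AddCircle.toCircle_zero (T := 2 * Real.pi)] at h2
  have := AddCircle.injective_toCircle (by positivity) h2
  simp at this
  exact h this

lemma key (S : Finset UnitCircle) : ∃ C : ℝ, 0 < C ∧ ∀ B : ℝ, ∃ (K : ℕ) (a : ℕ → ℂ), a 0 = 0 ∧
    (∀ t : UnitCircle,
      ‖∑ j ∈ Finset.range K, a j * (fourier (-(j : ℤ)) t - fourier (j : ℤ) t)‖ ≤ C) ∧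
    (∀ x ∈ S, x ≠ 0 → ‖∑ j ∈ Finset.range K, a j * fourier (-(j : ℤ)) x‖ ≤ C) ∧
    B ≤ ‖∑ j ∈ Finset.range K, a j‖ := by
  have hS0 : 0 ≤ ∑ x ∈ S, ‖log (1 - fourier (-1) x)‖ :=
    Finset.sum_nonneg fun _ _ => norm_nonneg _
  refine ⟨2 * Real.pi + 2 + ∑ x ∈ S, ‖log (1 - fourier (-1) x)‖,
    by linarith [Real.pi_pos], fun B => ?_⟩
  have hb : ∀ᶠ r : ℝ in 𝓝[<] 1, B + 1 ≤ ‖log (1 - (r : ℂ))‖ := by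
    have h1 : Tendsto (fun r : ℝ => 1 - r) (𝓝[<] 1) (𝓝[>] 0) := by
      refine tendsto_nhdsWithin_iff.2 ⟨?_, ?_⟩
      · have : Tendsto (fun r : ℝ => 1 - r) (𝓝 1) (𝓝 (1 - 1)) := by
          apply Continuous.tendsto; fun_prop
        rw [sub_self] at this
        exact this.mono_left nhdsWithin_le_nhds
      · filter_upwards [self_mem_nhdsWithin] with r hr
        simpa using hr
    have h2 := Real.tendsto_log_nhdsGT_zero.comp h1
    filter_upwards [h2.eventually (eventually_le_atBot (-(B + 1)))] with r hr
    have h3 := Complex.abs_re_le_norm (log (1 - (r : ℂ)))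
    rw [Complex.log_re] at h3
    have h4 : ‖(1 - (r : ℂ))‖ = |1 - r| := by
      rw [← Real.norm_eq_abs, ← Complex.norm_real]; push_cast; rfl
    rw [h4, Real.log_abs] at h3
    simp only [Function.comp] at hr
    linarith [neg_le_abs (Real.log (1 - r))]
  have hx : ∀ᶠ r : ℝ in 𝓝[<] 1, ∀ x ∈ S, x ≠ 0 →
      ‖log (1 - (r : ℂ) * fourier (-1) x)‖ ≤ ‖log (1 - fourier (-1) x)‖ + 1 := by
    rw [Filter.eventually_all_finset]
    intro x _
    by_cases h0 : x = 0
    · simp [h0]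
    have hs : 1 - ((1 : ℝ) : ℂ) * fourier (-1) x ∈ slitPlane := by
      left
      have hn := fourier_norm_apply (-1) x
      have hne := fourier_ne_one x h0
      generalize (fourier (-1) x : ℂ) = z at hn hne
      have hre := Complex.re_le_norm z
      rw [hn] at hre
      simp only [ofReal_one, one_mul, sub_re, one_re]
      rcases hre.lt_or_eq with h | h
      · linarith
      · exfalso
        apply hne
        have h5 : z.re ^ 2 + z.im ^ 2 = 1 := by
          have := Complex.sq_norm z
          rw [hn, Complex.normSq_apply] at this
          nlinarith
        apply Complex.ext
        · simpa using h
        · rw [h] at h5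
          have : z.im ^ 2 = 0 := by linarith
          simpa using this
    have hc : ContinuousAt (fun r : ℝ => ‖log (1 - (r : ℂ) * fourier (-1) x)‖) 1 := by
      apply ContinuousAt.norm
      exact ContinuousAt.clog (f := fun r : ℝ => 1 - (r : ℂ) * fourier (-1) x) (by fun_prop) hs
    have h6 := (hc.tendsto.mono_left (nhdsWithin_le_nhds (s := Iio 1))).eventually
      (gt_mem_nhds (show _ < ‖log (1 - fourier (-1) x)‖ + 1 by
        rw [ofReal_one, one_mul]; exact lt_add_one _))
    filter_upwards [h6] with r hr _ using hr.le
  have h01 : ∀ᶠ r : ℝ in 𝓝[<] 1, 0 < r ∧ r < 1 := by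
    filter_upwards [Ioo_mem_nhdsLT (zero_lt_one' ℝ)] with r hr using hr
  obtain ⟨r, ⟨hb, hx⟩, h0, h1⟩ := ((hb.and hx).and h01).exists
  obtain ⟨K, hK⟩ := log_trunc r h0 h1
  have hP (t : UnitCircle) : ∑ j ∈ Finset.range K, ((r : ℂ) ^ j / j) * fourier (-(j : ℤ)) t =
      ∑ j ∈ Finset.range K, ((r : ℂ) * fourier (-1) t) ^ j / j := by
    refine Finset.sum_congr rfl fun j _ => ?_
    rw [fourier_negnat, mul_pow]; ring
  have hnr (t : UnitCircle) : ‖(r : ℂ) * fourier (-1) t‖ = r := by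
    rw [norm_mul, fourier_norm_apply, mul_one, Complex.norm_real, Real.norm_of_nonneg h0.le]
  refine ⟨K, fun j => (r : ℂ) ^ j / j, by simp, fun t => ?_, fun x hxS hx0 => ?_, ?_⟩
  · have e : ∑ j ∈ Finset.range K, ((r : ℂ) ^ j / j) * (fourier (-(j : ℤ)) t - fourier (j : ℤ) t) =
        ((2 * (∑ j ∈ Finset.range K, ((r : ℂ) * fourier (-1) t) ^ j / j).im : ℝ) : ℂ) * I := by
      rw [← Complex.sub_conj, ← hP, map_sum, ← Finset.sum_sub_distrib]
      refine Finset.sum_congr rfl fun j _ => ?_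
      rw [map_mul, fourier_neg, Complex.conj_conj]
      simp only [map_div₀, map_pow, Complex.conj_ofReal, Complex.conj_natCast]
      ring
    rw [e]
    have h7 := (Complex.abs_im_le_norm _).trans (hK _ (hnr t))
    rw [Complex.add_im, Complex.log_im] at h7
    have h8 := Complex.abs_arg_le_pi (1 - (r : ℂ) * fourier (-1) t)
    rw [norm_mul, Complex.norm_I, mul_one, Complex.norm_real, Real.norm_eq_abs]
    rw [abs_le] at *
    constructor <;> linarith
  · rw [hP]
    have h7 := hK _ (hnr x)
    have h8 := hx x hxS hx0
    have h9 : ‖log (1 - fourier (-1) x)‖ ≤ ∑ x ∈ S, ‖log (1 - fourier (-1) x)‖ :=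
      Finset.single_le_sum (f := fun x : UnitCircle => ‖log (1 - fourier (-1) x)‖)
        (fun _ _ => norm_nonneg _) hxS
    have h10 := norm_sub_le ((∑ j ∈ Finset.range K, ((r : ℂ) * fourier (-1) x) ^ j / j) +
      log (1 - (r : ℂ) * fourier (-1) x)) (log (1 - (r : ℂ) * fourier (-1) x))
    rw [add_sub_cancel_right] at h10
    linarith [Real.pi_pos]
  · have h7 := hK (r : ℂ) (by rw [Complex.norm_real, Real.norm_of_nonneg h0.le])
    have h10 := norm_sub_le ((∑ j ∈ Finset.range K, (r : ℂ) ^ j / j) + log (1 - (r : ℂ)))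
      (∑ j ∈ Finset.range K, (r : ℂ) ^ j / j)
    rw [add_sub_cancel_left] at h10
    linarith

/-- the modulated bump at `e` -/
def bump (a : ℕ → ℂ) (K M : ℕ) (e : UnitCircle) : C(UnitCircle, ℂ) :=
  ∑ j ∈ Finset.range K, ((a j * fourier (-(j : ℤ)) (-e)) • fourier ((M : ℤ) + -(j : ℤ)) -
    (a j * fourier (j : ℤ) (-e)) • fourier ((M : ℤ) + j))

lemma fourier_pt_add (k : ℤ) (s t : UnitCircle) :
    (fourier k (s + t) : ℂ) = fourier k s * fourier k t := by
  simp only [fourier_apply, smul_add, AddCircle.toCircle_add, Circle.coe_mul]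

lemma bump_apply (a : ℕ → ℂ) (K M : ℕ) (e t : UnitCircle) :
    bump a K M e t = fourier (M : ℤ) t *
      ∑ j ∈ Finset.range K, a j * (fourier (-(j : ℤ)) (t - e) - fourier (j : ℤ) (t - e)) := by
  unfold bump
  rw [ContinuousMap.coe_sum, Finset.sum_apply, Finset.mul_sum]
  refine Finset.sum_congr rfl fun j _ => ?_
  rw [sub_eq_add_neg t e, fourier_pt_add, fourier_pt_add, ContinuousMap.sub_apply,
    ContinuousMap.smul_apply, ContinuousMap.smul_apply, fourier_add, fourier_add, smul_eq_mul,
    smul_eq_mul]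
  ring

lemma psL_bump (a : ℕ → ℂ) (ha : a 0 = 0) (K M : ℕ) (hKM : K ≤ M) (e t : UnitCircle) :
    psL M (bump a K M e) t = fourier (M : ℤ) t *
      ∑ j ∈ Finset.range K, a j * fourier (-(j : ℤ)) (t - e) := by
  unfold bump
  rw [map_sum, ContinuousMap.coe_sum, Finset.sum_apply, Finset.mul_sum]
  refine Finset.sum_congr rfl fun j hj => ?_
  rw [Finset.mem_range] at hj
  rcases Nat.eq_zero_or_pos j with rfl | hj0
  · simp [ha]
  rw [map_sub, map_smul, map_smul, psL_fourier, psL_fourier, if_pos (by rw [abs_le]; omega),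
    if_neg (by rw [abs_le]; omega), smul_zero, sub_zero, sub_eq_add_neg t e, fourier_pt_add,
    ContinuousMap.smul_apply, fourier_add, smul_eq_mul]
  ring

lemma approx (E : Finset UnitCircle) (w : UnitCircle → ℂ) (ε : ℝ) (hε : 0 < ε) (N : ℕ) :
    ∃ n ≥ N, ∃ h : C(UnitCircle, ℂ), ‖h‖ < ε ∧ ∀ t ∈ E, ‖psL n h t - w t‖ < ε := by
  classical
  obtain ⟨C, hC, hkey⟩ := key ((E ×ˢ E).image fun p => p.1 - p.2)
  set W : ℝ := ∑ e ∈ E, ‖w e‖ with hW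
  have hW0 : 0 ≤ W := Finset.sum_nonneg fun _ _ => norm_nonneg _
  set B : ℝ := (W * C) / ε + 1 with hB
  have hB0 : 0 < B := by positivity
  obtain ⟨K, a, ha, hbd, hoff, hbig⟩ := hkey B
  set A : ℂ := ∑ j ∈ Finset.range K, a j with hA
  have hA0 : 0 < ‖A‖ := hB0.trans_le hbig
  have hAne : A ≠ 0 := norm_pos_iff.1 hA0
  have hlt : W / ‖A‖ * C < ε := by
    rw [div_mul_eq_mul_div, div_lt_iff₀ hA0]
    have : W * C < ε * B := by
      rw [hB, mul_add, mul_div_cancel₀ _ hε.ne']; linarith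
    nlinarith
  set M := max N K with hM
  let c : UnitCircle → ℂ := fun e => w e * fourier (-(M : ℤ)) e / A
  have hcn (e : UnitCircle) : ‖c e‖ = ‖w e‖ / ‖A‖ := by
    simp only [c, norm_div, norm_mul, fourier_norm_apply, mul_one]
  refine ⟨M, le_max_left _ _, ∑ e ∈ E, c e • bump a K M e, ?_, fun t ht => ?_⟩
  · refine lt_of_le_of_lt ?_ hlt
    rw [hW, Finset.sum_div, Finset.sum_mul]
    refine (norm_sum_le _ _).trans (Finset.sum_le_sum fun e _ => ?_)
    rw [norm_smul, hcn]
    refine mul_le_mul_of_nonneg_left ?_ (by positivity)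
    rw [ContinuousMap.norm_le _ hC.le]
    intro t
    rw [bump_apply, norm_mul, fourier_norm_apply, one_mul]
    exact hbd _
  · refine lt_of_le_of_lt ?_ hlt
    rw [map_sum, ContinuousMap.coe_sum, Finset.sum_apply, ← Finset.add_sum_erase _ _ ht]
    simp only [map_smul, ContinuousMap.smul_apply, psL_bump a ha K M (le_max_right _ _), smul_eq_mul]
    have h1 : c t * (fourier (M : ℤ) t * ∑ j ∈ Finset.range K, a j * fourier (-(j : ℤ)) (t - t))
        = w t := by
      simp only [sub_self, fourier_eval_zero, mul_one, c]
      rw [← hA]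
      have : (fourier (-(M : ℤ)) t : ℂ) * fourier (M : ℤ) t = 1 := by
        rw [← fourier_add]; simp
      field_simp
      linear_combination w t * this
    rw [h1, add_sub_cancel_left, hW, Finset.sum_div, Finset.sum_mul]
    refine (norm_sum_le _ _).trans ?_
    refine le_trans (Finset.sum_le_sum (g := fun e => ‖w e‖ / ‖A‖ * C) fun e he => ?_)
      (Finset.sum_le_sum_of_subset_of_nonneg (Finset.erase_subset t E)
        fun _ _ _ => by positivity)
    rw [Finset.mem_erase] at he
    rw [norm_mul, norm_mul, fourier_norm_apply, one_mul, hcn]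
    refine mul_le_mul_of_nonneg_left (hoff _ ?_ ?_) (by positivity)
    · exact Finset.mem_image.2 ⟨(t, e), Finset.mem_product.2 ⟨ht, he.2⟩, rfl⟩
    · exact sub_ne_zero.2 he.1.symm

theorem stmt4 (E : Set UnitCircle) (hE : E.Finite) :
    IsGδ {f : C(UnitCircle, ℂ) |
        Dense (Set.range fun n => fun t : E => partialSum n ⇑f t)} ∧
      Dense {f : C(UnitCircle, ℂ) |
        Dense (Set.range fun n => fun t : E => partialSum n ⇑f t)} := by
  classical
  have : Fintype E := hE.fintype
  have hbasis := isBasis_countableBasis (E → ℂ)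
  set b := countableBasis (E → ℂ)
  have hbc : b.Countable := countable_countableBasis (E → ℂ)
  let O : Set (E → ℂ) → Set C(UnitCircle, ℂ) := fun V =>
    ⋃ n : ℕ, {f | (fun t : E => partialSum n ⇑f t) ∈ V}
  have heq : {f : C(UnitCircle, ℂ) |
      Dense (Set.range fun n => fun t : E => partialSum n ⇑f t)} = ⋂ V ∈ b, O V := by
    ext f
    rw [mem_ofPred_eq, hbasis.dense_iff]
    simp only [mem_iInter, O, mem_iUnion, mem_ofPred_eq]
    constructor
    · intro h V hV
      obtain ⟨_, hx, n, rfl⟩ := h V hV (nonempty_of_mem_countableBasis hV)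
      exact ⟨n, hx⟩
    · intro h V hV _
      obtain ⟨n, hn⟩ := h V hV
      exact ⟨_, hn, n, rfl⟩
  have hopen : ∀ V ∈ b, IsOpen (O V) := fun V hV => by
    refine isOpen_iUnion fun n => ?_
    have hcont : Continuous fun f : C(UnitCircle, ℂ) => fun t : E => partialSum n ⇑f t :=
      continuous_pi fun t => continuous_ps n t
    exact (hbasis.isOpen hV).preimage hcont
  have hdense : ∀ V ∈ b, Dense (O V) := fun V hV => by
    obtain ⟨v, hv⟩ := nonempty_of_mem_countableBasis hV
    obtain ⟨δ, hδ, hball⟩ := Metric.isOpen_iff.1 (hbasis.isOpen hV) v hv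
    rw [Metric.dense_iff]
    intro g ρ hρ
    have hg : g ∈ closure (Submodule.span ℂ (range (@fourier (2 * Real.pi))) :
        Set C(UnitCircle, ℂ)) := by
      rw [← Submodule.topologicalClosure_coe, span_fourier_closure_eq_top]; trivial
    obtain ⟨p, hp, hgp⟩ := Metric.mem_closure_iff.1 hg (ρ / 2) (by positivity)
    obtain ⟨N, hN⟩ := eventually_ps p hp
    obtain ⟨n, hn, h, hh, happ⟩ := approx hE.toFinset
      (fun t => if ht : t ∈ E then v ⟨t, ht⟩ - p t else 0) (min (ρ / 2) δ)
      (lt_min (by positivity) hδ) N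
    refine ⟨p + h, ?_, mem_iUnion.2 ⟨n, hball ?_⟩⟩
    · rw [Metric.mem_ball]
      have h1 : dist (p + h) p < ρ / 2 := by
        rw [dist_eq_norm, add_sub_cancel_left]; exact hh.trans_le (min_le_left _ _)
      have h2 := dist_triangle (p + h) p g
      rw [dist_comm] at hgp
      linarith
    · rw [Metric.mem_ball, dist_pi_lt_iff hδ]
      intro t
      have h1 := happ t (hE.mem_toFinset.2 t.2)
      rw [dif_pos t.2] at h1
      change dist (psL n (p + h) t) _ < δ
      rw [map_add, hN n hn, dist_eq_norm, ContinuousMap.add_apply]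
      refine lt_of_eq_of_lt ?_ (h1.trans_le (min_le_right _ _))
      congr 1
      simp only [Subtype.coe_eta]
      ring
  rw [heq]
  exact ⟨IsGδ.biInter hbc fun V hV => (hopen V hV).isGδ,
    dense_biInter_of_isOpen hopen hbc hdense⟩
end
end

section
/- For every infinite set Λ ⊆ ℕ and every point t₀ ∈ 𝕋, the set of f ∈ C(𝕋) such that {sₙf(t₀) : n ∈ Λ} is dense in ℂ is a dense G_δ subset of C(𝕋). -/
open MeasureTheory Complex Filter Topology Set TopologicalSpace

noncomputable section

/-- Fourier coefficient as a continuous linear functional. -/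
def coefCLM (k : ℤ) : C(UnitCircle, ℂ) →L[ℂ] ℂ :=
  LinearMap.mkContinuous
    { toFun := fun f => fourierCoeff (⇑f) k
      map_add' := fun f g => by
        have hf : Integrable (⇑f) (AddCircle.haarAddCircle (T := 2 * Real.pi)) :=
          f.continuous.integrable_of_hasCompactSupport (HasCompactSupport.of_compactSpace _)
        have hg : Integrable (⇑g) (AddCircle.haarAddCircle (T := 2 * Real.pi)) :=
          g.continuous.integrable_of_hasCompactSupport (HasCompactSupport.of_compactSpace _)
        have := fourierCoeff.add hf hg
        exact congrFun this k
      map_smul' := fun c f => by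
        exact fourierCoeff.const_smul (⇑f) c k } 1 (fun f => by
      change ‖fourierCoeff (⇑f) k‖ ≤ 1 * ‖f‖
      unfold fourierCoeff
      have h := norm_integral_le_of_norm_le_const
        (μ := AddCircle.haarAddCircle (T := 2 * Real.pi)) (C := ‖f‖)
        (f := fun t => fourier (-k) t • f t) (Eventually.of_forall fun t => by
          rw [norm_smul]
          have h1 : ‖(fourier (-k) t : ℂ)‖ = 1 := by rw [fourier_apply]; exact Circle.norm_coe _
          rw [h1, one_mul]
          exact f.norm_coe_le_norm t)
      simpa using h)

theorem coefCLM_apply (k : ℤ) (f : C(UnitCircle, ℂ)) : coefCLM k f = fourierCoeff (⇑f) k := rfl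

/-- Evaluation of the partial sum as a continuous linear functional. -/
def sCLM (t₀ : UnitCircle) (n : ℕ) : C(UnitCircle, ℂ) →L[ℂ] ℂ :=
  ∑ k ∈ Finset.Icc (-(n : ℤ)) (n : ℤ), (fourier k t₀ : ℂ) • coefCLM k

theorem sCLM_apply (t₀ : UnitCircle) (n : ℕ) (f : C(UnitCircle, ℂ)) :
    sCLM t₀ n f = partialSum n (⇑f) t₀ := by
  simp [sCLM, partialSum, coefCLM_apply, ContinuousLinearMap.sum_apply, ContinuousMap.sum_apply,
    mul_comm]

theorem sCLM_fourier (t₀ : UnitCircle) (n : ℕ) (m : ℤ) :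
    sCLM t₀ n (fourier m) = if m ∈ Finset.Icc (-(n : ℤ)) (n : ℤ) then (fourier m t₀ : ℂ) else 0 := by
  simp only [sCLM, ContinuousLinearMap.sum_apply, ContinuousLinearMap.smul_apply, coefCLM_apply,
    fourierCoeff_fourier, smul_eq_mul, Pi.single_apply, mul_ite, mul_one, mul_zero]
  rw [Finset.sum_ite_eq']

/-- Terms of the Fejér-type series. -/
def fterm (t₀ : UnitCircle) (n : ℕ) (r : ℝ) (k : ℕ) : C(UnitCircle, ℂ) :=
  ((r : ℂ) ^ k / k) • ((fourier (-(k : ℤ)) t₀ : ℂ) • fourier ((n : ℤ) + k)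
    - (fourier (k : ℤ) t₀ : ℂ) • fourier ((n : ℤ) - k))

theorem norm_fourier_apply' (k : ℤ) (t : UnitCircle) : ‖(fourier k t : ℂ)‖ = 1 := by
  rw [fourier_apply]; exact Circle.norm_coe _

theorem fterm_norm (t₀ : UnitCircle) (n : ℕ) {r : ℝ} (h0 : 0 ≤ r) (k : ℕ) :
    ‖fterm t₀ n r k‖ ≤ 2 * r ^ k := by
  unfold fterm
  rw [norm_smul]
  have h1 : ‖((r : ℂ) ^ k / k)‖ ≤ r ^ k := by
    rw [norm_div, norm_pow, Complex.norm_real, Real.norm_of_nonneg h0, Complex.norm_natCast]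
    rcases Nat.eq_zero_or_pos k with rfl | hk
    · simp
    · exact div_le_self (pow_nonneg h0 k) (by exact_mod_cast hk)
  have h2 : ‖((fourier (-(k : ℤ)) t₀ : ℂ) • fourier ((n : ℤ) + k)
    - (fourier (k : ℤ) t₀ : ℂ) • fourier ((n : ℤ) - k) : C(UnitCircle, ℂ))‖ ≤ 2 := by
    refine (norm_sub_le _ _).trans ?_
    rw [norm_smul, norm_smul, norm_fourier_apply', norm_fourier_apply', fourier_norm, fourier_norm]
    norm_num
  calc _ ≤ r ^ k * 2 := mul_le_mul h1 h2 (norm_nonneg _) (pow_nonneg h0 k)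
    _ = _ := mul_comm _ _

theorem fterm_summable (t₀ : UnitCircle) (n : ℕ) {r : ℝ} (h0 : 0 ≤ r) (h1 : r < 1) :
    Summable (fterm t₀ n r) :=
  Summable.of_norm_bounded ((summable_geometric_of_lt_one h0 h1).mul_left 2)
    (fterm_norm t₀ n h0)

theorem fourier_nat_mul (k : ℕ) (t : UnitCircle) :
    (fourier (k : ℤ) t : ℂ) = (fourier 1 t : ℂ) ^ k := by
  induction k with
  | zero => simp
  | succ k ih => rw [Nat.cast_succ, fourier_add, ih, pow_succ]

theorem fterm_tsum_norm (t₀ : UnitCircle) (n : ℕ) {r : ℝ} (h0 : 0 ≤ r) (h1 : r < 1) :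
    ‖∑' k, fterm t₀ n r k‖ ≤ 2 * Real.pi := by
  rw [ContinuousMap.norm_le _ (by positivity)]
  intro t
  set z : ℂ := r * ((fourier (-1) t₀ : ℂ) * fourier 1 t) with hz
  have hzn : ‖z‖ < 1 := by
    rw [hz, norm_mul, norm_mul, norm_fourier_apply', norm_fourier_apply', Complex.norm_real,
      Real.norm_of_nonneg h0]
    simpa using h1
  have hL := Complex.hasSum_taylorSeries_neg_log hzn
  have hLc := hL.map (starRingEnd ℂ) Complex.continuous_conj
  have hS := (hL.sub hLc).mul_left (fourier (n : ℤ) t : ℂ)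
  have hg := ((fterm_summable t₀ n h0 h1).hasSum).map
    (ContinuousMap.evalCLM ℂ t : C(UnitCircle, ℂ) →L[ℂ] ℂ) (ContinuousLinearMap.continuous _)
  have heq : (fun k : ℕ => (fourier (n : ℤ) t : ℂ) * (z ^ k / k -
      ((starRingEnd ℂ) ∘ fun n : ℕ => z ^ n / (n : ℂ)) k)) =
      (ContinuousMap.evalCLM ℂ t : C(UnitCircle, ℂ) →L[ℂ] ℂ) ∘ fterm t₀ n r := by
    funext k
    simp only [Function.comp, fterm, ContinuousMap.evalCLM_apply, ContinuousMap.smul_apply,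
      ContinuousMap.sub_apply, smul_eq_mul, map_div₀, map_pow, hz, map_mul, Complex.conj_ofReal,
      map_natCast, sub_eq_add_neg (n : ℤ), fourier_add, fourier_neg, fourier_nat_mul,
      Complex.conj_conj]
    ring
  rw [heq] at hS
  have h := hg.unique hS
  rw [ContinuousMap.evalCLM_apply] at h
  rw [h, norm_mul, norm_fourier_apply', one_mul, Complex.sub_conj]
  simp only [norm_mul, Complex.norm_I, mul_one, Complex.norm_real, Complex.neg_im, Complex.log_im,
    Real.norm_eq_abs]
  have := Complex.abs_arg_le_pi (1 - z)
  rw [abs_neg, abs_two]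
  linarith

theorem sCLM_tsum (t₀ : UnitCircle) (n : ℕ) {r : ℝ} (h0 : 0 ≤ r) (h1 : r < 1) :
    ‖sCLM t₀ n (∑' k, fterm t₀ n r k)‖ = ∑ k ∈ Finset.range (2 * n + 1), r ^ k / k := by
  rw [ContinuousLinearMap.map_tsum _ (fterm_summable t₀ n h0 h1)]
  have key : ∀ k : ℕ, sCLM t₀ n (fterm t₀ n r k) =
      if k ∈ Finset.range (2 * n + 1) then -(fourier (n : ℤ) t₀ : ℂ) * (r ^ k / k) else 0 := by
    intro k
    rcases Nat.eq_zero_or_pos k with rfl | hk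
    · simp [fterm]
    · have a1 : ¬ ((n : ℤ) + k ∈ Finset.Icc (-(n : ℤ)) (n : ℤ)) := by
        rw [Finset.mem_Icc]; omega
      have a2 : ((n : ℤ) - k ∈ Finset.Icc (-(n : ℤ)) (n : ℤ)) ↔ k ∈ Finset.range (2 * n + 1) := by
        rw [Finset.mem_Icc, Finset.mem_range]; omega
      simp only [fterm, map_smul, map_sub, sCLM_fourier, if_neg a1, a2, smul_eq_mul]
      split_ifs
      · have : (fourier (k : ℤ) t₀ : ℂ) * fourier ((n : ℤ) - k) t₀ = fourier (n : ℤ) t₀ := by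
          rw [← fourier_add]; congr 2; ring
        rw [this]; ring
      · simp
  rw [tsum_congr key, tsum_eq_sum (s := Finset.range (2 * n + 1)) (fun b hb => if_neg hb),
    Finset.sum_congr rfl (fun k hk => if_pos hk), ← Finset.mul_sum, norm_mul, norm_neg,
    norm_fourier_apply', one_mul]
  have : (∑ k ∈ Finset.range (2 * n + 1), (r : ℂ) ^ k / k) =
      ((∑ k ∈ Finset.range (2 * n + 1), r ^ k / k : ℝ) : ℂ) := by push_cast; rfl
  rw [this, Complex.norm_real, Real.norm_of_nonneg]
  exact Finset.sum_nonneg fun k _ => by positivity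

theorem exists_large (t₀ : UnitCircle) (M : ℝ) : ∀ᶠ n : ℕ in atTop,
    ∃ g : C(UnitCircle, ℂ), ‖g‖ ≤ 2 * Real.pi ∧ M < ‖sCLM t₀ n g‖ := by
  have hH := Real.tendsto_sum_range_one_div_nat_succ_atTop.eventually_gt_atTop M
  filter_upwards [hH] with n hn
  have hc : Continuous fun r : ℝ => ∑ k ∈ Finset.range (2 * n + 1), r ^ k / k := by fun_prop
  have h1 : M < ∑ k ∈ Finset.range (2 * n + 1), (1 : ℝ) ^ k / k := by
    refine hn.trans_le ?_
    rw [Finset.sum_range_succ']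
    simp only [one_pow, Nat.cast_zero, div_zero, add_zero]
    push_cast
    exact Finset.sum_le_sum_of_subset_of_nonneg
      (Finset.range_subset_range.2 (by omega)) (fun _ _ _ => by positivity)
  have h2 : ∀ᶠ r : ℝ in 𝓝[<] 1, M < ∑ k ∈ Finset.range (2 * n + 1), r ^ k / k :=
    (hc.continuousAt.eventually (lt_mem_nhds h1)).filter_mono nhdsWithin_le_nhds
  have h3 : ∀ᶠ r : ℝ in 𝓝[<] 1, 0 ≤ r :=
    (le_mem_nhds (zero_lt_one : (0 : ℝ) < 1)).filter_mono nhdsWithin_le_nhds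
  have h4 : ∀ᶠ r : ℝ in 𝓝[<] (1 : ℝ), r < 1 := self_mem_nhdsWithin
  obtain ⟨r, hr1, hr2, hr3⟩ := (h2.and (h3.and h4)).exists
  exact ⟨_, fterm_tsum_norm t₀ n hr2 hr3, by rwa [sCLM_tsum t₀ n hr2 hr3]⟩

theorem exists_small (t₀ : UnitCircle) (w : ℂ) {δ : ℝ} (hδ : 0 < δ) : ∀ᶠ n : ℕ in atTop,
    ∃ g : C(UnitCircle, ℂ), ‖g‖ < δ ∧ sCLM t₀ n g = w := by
  have hpi := Real.pi_pos
  filter_upwards [exists_large t₀ (‖w‖ * (2 * Real.pi) / δ)] with n ⟨g, hg, hM⟩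
  have hpos : 0 < ‖sCLM t₀ n g‖ := lt_of_le_of_lt (by positivity) hM
  refine ⟨(w / sCLM t₀ n g) • g, ?_, ?_⟩
  · rw [norm_smul, norm_div]
    rw [div_lt_iff₀ hδ] at hM
    rw [div_mul_eq_mul_div, div_lt_iff₀ hpos]
    calc ‖w‖ * ‖g‖ ≤ ‖w‖ * (2 * Real.pi) := by gcongr
      _ < _ := by linarith
  · rw [map_smul, smul_eq_mul, div_mul_cancel₀]
    exact norm_pos_iff.1 hpos

theorem sCLM_span (t₀ : UnitCircle) (p : C(UnitCircle, ℂ))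
    (hp : p ∈ Submodule.span ℂ (range (fourier (T := 2 * Real.pi)))) :
    ∀ᶠ n : ℕ in atTop, sCLM t₀ n p = p t₀ := by
  induction hp using Submodule.span_induction with
  | mem x hx =>
    obtain ⟨m, rfl⟩ := hx
    filter_upwards [eventually_ge_atTop m.natAbs] with n hn
    rw [sCLM_fourier, if_pos]
    rw [Finset.mem_Icc]; omega
  | zero => simp
  | add x y _ _ hx hy =>
    filter_upwards [hx, hy] with n h1 h2
    simp [h1, h2]
  | smul a x _ hx =>
    filter_upwards [hx] with n h1
    simp [h1]

theorem stmt7 (Λ : Set ℕ) (hΛ : Λ.Infinite) (t₀ : UnitCircle) :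
    IsGδ {f : C(UnitCircle, ℂ) | Dense ((fun n => partialSum n ⇑f t₀) '' Λ)} ∧
      Dense {f : C(UnitCircle, ℂ) | Dense ((fun n => partialSum n ⇑f t₀) '' Λ)} := by
  have hset : {f : C(UnitCircle, ℂ) | Dense ((fun n => partialSum n ⇑f t₀) '' Λ)} =
      ⋂ V ∈ countableBasis ℂ, ⋃ n ∈ Λ, (sCLM t₀ n) ⁻¹' V := by
    ext f
    simp only [mem_setOf_eq, mem_iInter, mem_iUnion, mem_preimage, sCLM_apply]
    rw [(isBasis_countableBasis ℂ).dense_iff]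
    refine forall₂_congr fun V hV => ?_
    constructor
    · intro h
      obtain ⟨_, hx, n, hn, rfl⟩ := h (nonempty_of_mem_countableBasis hV)
      exact ⟨n, hn, hx⟩
    · rintro ⟨n, hn, hx⟩ _
      exact ⟨_, hx, n, hn, rfl⟩
  have hopen : ∀ V ∈ countableBasis ℂ, IsOpen (⋃ n ∈ Λ, (sCLM t₀ n) ⁻¹' V) := fun V hV =>
    isOpen_biUnion fun n _ => (isOpen_of_mem_countableBasis hV).preimage (sCLM t₀ n).continuous
  rw [hset]
  refine ⟨IsGδ.biInter_of_isOpen (countable_countableBasis ℂ) hopen,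
    dense_biInter_of_isOpen hopen (countable_countableBasis ℂ) ?_⟩
  intro V hV
  obtain ⟨v, hv⟩ := nonempty_of_mem_countableBasis hV
  rw [Metric.dense_iff]
  intro f ε hε
  have hd : f ∈ closure (Submodule.span ℂ (range (fourier (T := 2 * Real.pi))) :
      Set C(UnitCircle, ℂ)) := by
    rw [← Submodule.topologicalClosure_coe, span_fourier_closure_eq_top]
    trivial
  obtain ⟨p, hp, hfp⟩ := Metric.mem_closure_iff.1 hd (ε / 2) (half_pos hε)
  obtain ⟨n, hnΛ, ⟨g, hg, hgn⟩, hpn⟩ := ((Nat.frequently_atTop_iff_infinite.2 hΛ).and_eventually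
    ((exists_small t₀ (v - p t₀) (half_pos hε)).and (sCLM_span t₀ p hp))).exists
  refine ⟨p + g, ?_, ?_⟩
  · rw [Metric.mem_ball, dist_eq_norm]
    rw [dist_comm, dist_eq_norm] at hfp
    calc ‖p + g - f‖ = ‖(p - f) + g‖ := by congr 1; abel
      _ ≤ _ := norm_add_le _ _
      _ < ε := by linarith
  · simp only [mem_iUnion, mem_preimage]
    refine ⟨n, hnΛ, ?_⟩
    rw [map_add, hgn, hpn]
    simpa using hv
end
end

section
/- For each countable set E ⊆ 𝕋 and each p with 1 ≤ p < ∞, quasi all f ∈ L^p(𝕋) have the property that for every function h : E → ℂ there is a subsequence of (sₙf) converging pointwise to h on E. -/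
open MeasureTheory Complex Filter Topology Set TopologicalSpace

open scoped ENNReal

noncomputable section

/-- For each countable `E ⊆ 𝕋` and `1 ≤ p < ∞`, quasi all `f ∈ L^p(𝕋)` have the property
that every `h : E → ℂ` is a pointwise limit on `E` of a subsequence of `(sₙ f)`. -/
lemma fourierCoeff_cont (p : ℝ≥0∞) [hp : Fact (1 ≤ p)] (k : ℤ) :
    Continuous (fun f : Lp ℂ p (@AddCircle.haarAddCircle (2 * Real.pi) _) =>
      fourierCoeff (⇑f) k) := by
  have hint : ∀ f : Lp ℂ p (@AddCircle.haarAddCircle (2 * Real.pi) _),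
      Integrable (⇑f) (@AddCircle.haarAddCircle (2 * Real.pi) _) :=
    fun f => (Lp.memLp f).integrable hp.out
  let L : Lp ℂ p (@AddCircle.haarAddCircle (2 * Real.pi) _) →+ ℂ :=
    AddMonoidHom.mk' (fun f => fourierCoeff (⇑f) k) (by
      intro f g
      rw [fourierCoeff_congr_ae (Lp.coeFn_add f g), fourierCoeff.add (hint f) (hint g)]
      rfl)
  refine AddMonoidHomClass.continuous_of_bound L 1 fun f => ?_
  change ‖∫ t, fourier (-k) t • f t ∂_‖ ≤ _
  refine (norm_integral_le_integral_norm _).trans ?_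
  have : ∀ t, ‖fourier (-k) t • f t‖ = ‖f t‖ := by
    intro t
    rw [norm_smul, fourier_apply, Circle.norm_coe, one_mul]
  simp_rw [this]
  rw [one_mul, Lp.norm_def, integral_norm_eq_lintegral_enorm (hint f).1, ← eLpNorm_one_eq_lintegral_enorm]
  exact ENNReal.toReal_mono (Lp.eLpNorm_ne_top f)
    (eLpNorm_le_eLpNorm_of_exponent_le hp.out (hint f).1)

lemma partialSum_cont (p : ℝ≥0∞) [hp : Fact (1 ≤ p)] (n : ℕ) (t : UnitCircle) :
    Continuous (fun f : Lp ℂ p (@AddCircle.haarAddCircle (2 * Real.pi) _) =>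
      partialSum n (⇑f) t) := by
  simp only [partialSum, ContinuousMap.sum_apply, ContinuousMap.smul_apply]
  exact continuous_finsetSum _ fun k _ => (fourierCoeff_cont p k).smul continuous_const

lemma partialSum_trig (P : C(UnitCircle, ℂ))
    (hP : P ∈ Submodule.span ℂ (range (@fourier (2 * Real.pi)))) :
    ∃ N : ℕ, ∀ n ≥ N, partialSum n P = P := by
  induction hP using Submodule.span_induction with
  | mem x hx =>
    obtain ⟨m, rfl⟩ := hx
    refine ⟨m.natAbs, fun n hn => ?_⟩
    rw [partialSum, fourierCoeff_fourier, Finset.sum_eq_single m]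
    · simp
    · intro b _ hb
      simp [Pi.single_eq_of_ne hb]
    · intro h
      exfalso
      apply h
      rw [Finset.mem_Icc]
      omega
  | zero => exact ⟨0, fun n _ => by simp [partialSum, fourierCoeff]⟩
  | add x y _ _ hx hy =>
    obtain ⟨N, hN⟩ := hx
    obtain ⟨M, hM⟩ := hy
    refine ⟨max N M, fun n hn => ?_⟩
    have h1 := hN n (le_trans (le_max_left _ _) hn)
    have h2 := hM n (le_trans (le_max_right _ _) hn)
    conv_rhs => rw [← h1, ← h2]
    have hi : ∀ x : C(UnitCircle, ℂ), Integrable (⇑x) (@AddCircle.haarAddCircle (2 * Real.pi) _) :=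
      fun x => x.continuous.integrable_of_hasCompactSupport (HasCompactSupport.of_compactSpace _)
    simp only [partialSum, ContinuousMap.coe_add]
    rw [fourierCoeff.add (hi x) (hi y), ← Finset.sum_add_distrib]
    simp only [Pi.add_apply, add_smul]
  | smul a x _ hx =>
    obtain ⟨N, hN⟩ := hx
    refine ⟨N, fun n hn => ?_⟩
    conv_rhs => rw [← hN n hn]
    simp only [partialSum, ContinuousMap.coe_smul, fourierCoeff.const_smul, Finset.smul_sum, smul_assoc]

lemma haar_singleton (x : UnitCircle) : (@AddCircle.haarAddCircle (2 * Real.pi) _) {x} = 0 := by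
  have h := AddCircle.volume_closedBall (T := 2 * Real.pi) (x := x) 0
  rw [Metric.closedBall_zero, AddCircle.volume_eq_smul_haarAddCircle] at h
  have hpi := Real.pi_pos
  have h0 : min (2 * Real.pi) (2 * 0) = 0 := by rw [mul_zero]; exact min_eq_right (by positivity)
  rw [h0, ENNReal.ofReal_zero, Measure.smul_apply, smul_eq_mul, mul_eq_zero] at h
  refine h.resolve_left ?_
  rw [ENNReal.ofReal_eq_zero, not_le]
  positivity

lemma approx_cont (p : ℝ≥0∞) [hp : Fact (1 ≤ p)] (hp' : p ≠ ⊤) (g : C(UnitCircle, ℂ))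
    (F : Finset UnitCircle) (h : UnitCircle → ℂ) {ε : ℝ≥0∞} (hε : ε ≠ 0) :
    ∃ f : C(UnitCircle, ℂ),
      eLpNorm (⇑g - ⇑f) p (@AddCircle.haarAddCircle (2 * Real.pi) _) ≤ ε ∧
      ∀ t ∈ F, ‖h t - f t‖ₑ ≤ ε := by
  classical
  set μ := (@AddCircle.haarAddCircle (2 * Real.pi) _) with hμ
  have : NullSingletonClass μ := ⟨haar_singleton⟩
  let ν : Measure UnitCircle := μ + ∑ t ∈ F, Measure.dirac t
  let G : UnitCircle → ℂ := fun x => if x ∈ F then h x else g x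
  have hne : {x | g x ≠ G x} ⊆ (F : Set UnitCircle) := by
    intro x hx
    by_contra hxF
    exact hx (by simp only [G]; rw [if_neg (by simpa using hxF)])
  have hGm : Measurable G :=
    g.continuous.measurable.measurable_of_countable_ne (F.countable_toSet.mono hne)
  have hG : MemLp G p ν := by
    refine MemLp.of_bound hGm.aestronglyMeasurable (‖g‖ + ∑ t ∈ F, ‖h t‖) (ae_of_all _ fun x => ?_)
    simp only [G]
    split_ifs with hx
    · have := Finset.single_le_sum (f := fun t => ‖h t‖) (fun _ _ => norm_nonneg _) hx
      have h2 := norm_nonneg g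
      linarith
    · have := g.norm_coe_le_norm x
      have h2 : 0 ≤ ∑ t ∈ F, ‖h t‖ := Finset.sum_nonneg fun _ _ => norm_nonneg _
      linarith
  obtain ⟨f, hf, -⟩ := hG.exists_boundedContinuous_eLpNorm_sub_le hp' hε
  refine ⟨f.toContinuousMap, ?_, fun t ht => ?_⟩
  · have hae : (⇑g - ⇑f) =ᵐ[μ] (G - ⇑f) := by
      have : ∀ᵐ x ∂μ, x ∉ (F : Set UnitCircle) :=
        measure_eq_zero_iff_ae_notMem.1 (F.countable_toSet.measure_zero μ)
      filter_upwards [this] with x hx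
      have : x ∉ F := by simpa using hx
      simp [G, this]
    change eLpNorm (⇑g - ⇑f) p μ ≤ ε
    rw [eLpNorm_congr_ae hae]
    exact (eLpNorm_mono_measure _ (Measure.le_add_right le_rfl)).trans hf
  · have h1 : eLpNorm (G - ⇑f) p (Measure.dirac t) ≤ ε :=
      (eLpNorm_mono_measure _ (Measure.le_add_left
        (Finset.single_le_sum (f := fun t => Measure.dirac t) (fun _ _ => Measure.zero_le _) ht))).trans hf
    rw [eLpNorm_dirac _ _ (by have := hp.out; rintro rfl; simp at this)] at h1
    simpa [G, ht] using h1

lemma dense_pair (E : Set UnitCircle) (p : ℝ≥0∞) [hp : Fact (1 ≤ p)]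
    (hp' : p ≠ ⊤) : DenseRange (fun f : C(UnitCircle, ℂ) =>
      ((ContinuousMap.toLp (E := ℂ) p (@AddCircle.haarAddCircle (2 * Real.pi) _) ℂ f,
        fun t : E => f t) : Lp ℂ p (@AddCircle.haarAddCircle (2 * Real.pi) _) × (E → ℂ))) := by
  classical
  set μ := (@AddCircle.haarAddCircle (2 * Real.pi) _) with hμ
  have hd := (ContinuousMap.toLp_denseRange ℂ μ ℂ hp').prodMap (denseRange_id (X := E → ℂ))
  refine fun x => closure_minimal ?_ isClosed_closure (hd x)
  rintro _ ⟨⟨g, h⟩, rfl⟩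
  -- approximating sequence indexed by finite sets and radii
  rw [mem_closure_iff_nhds]
  intro s hs
  rw [nhds_prod_eq, Filter.mem_prod_iff] at hs
  obtain ⟨A, hA, B, hB, hAB⟩ := hs
  obtain ⟨ε, hε, hεA⟩ := EMetric.mem_nhds_iff.1 hA
  simp only [id, Prod.map_apply] at hB
  rw [nhds_pi, Filter.mem_pi] at hB
  obtain ⟨I, hI, V, hV, hVB⟩ := hB
  have : ∀ i : E, ∃ δ > 0, Metric.eball (h i) δ ⊆ V i := fun i => EMetric.mem_nhds_iff.1 (hV i)
  choose δ hδ hδV using this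
  obtain ⟨η, hη, hη1, hη2⟩ : ∃ η : ℝ≥0∞, 0 < η ∧ η < ε ∧ ∀ i ∈ I, η < δ i := by
    have h1 : ∀ᶠ η in 𝓝[>] (0 : ℝ≥0∞), η < ε := nhdsWithin_le_nhds (Iio_mem_nhds hε)
    have h2 : ∀ᶠ η in 𝓝[>] (0 : ℝ≥0∞), ∀ i ∈ I, η < δ i :=
      (Filter.eventually_all_finite hI).2 fun i _ => nhdsWithin_le_nhds (Iio_mem_nhds (hδ i))
    have h0 : ∀ᶠ η in 𝓝[>] (0 : ℝ≥0∞), 0 < η := self_mem_nhdsWithin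
    obtain ⟨η, ha, hb, hc⟩ := (h0.and (h1.and h2)).exists
    exact ⟨η, ha, hb, hc⟩
  obtain ⟨f, hf1, hf2⟩ := approx_cont p hp' g ((hI.image (Subtype.val)).toFinset)
    (fun x => if hx : x ∈ E then h ⟨x, hx⟩ else 0) hη.ne'
  refine ⟨_, hAB ⟨hεA ?_, hVB fun i hi => hδV i ?_⟩, f, rfl⟩
  · rw [Metric.mem_eball']
    refine lt_of_le_of_lt ?_ hη1
    rw [Lp.edist_def]
    refine le_trans (le_of_eq (eLpNorm_congr_ae ?_)) hf1
    exact (ContinuousMap.coeFn_toLp μ g).sub (ContinuousMap.coeFn_toLp μ f)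
  · rw [Metric.mem_eball']
    refine lt_of_le_of_lt ?_ (hη2 i hi)
    have := hf2 i (by simpa using hi)
    simpa [edist_eq_enorm_sub] using this

/-- For each countable `E ⊆ 𝕋` and `1 ≤ p < ∞`, quasi all `f ∈ L^p(𝕋)` have the property
that every `h : E → ℂ` is a pointwise limit on `E` of a subsequence of `(sₙ f)`. -/
theorem stmt16 (E : Set UnitCircle) (hE : E.Countable) (p : ℝ≥0∞) [hp : Fact (1 ≤ p)]
    (hp' : p ≠ ⊤) :
    {f : Lp ℂ p (@AddCircle.haarAddCircle (2 * Real.pi) _) |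
      ∀ h : E → ℂ, ∃ φ : ℕ → ℕ, StrictMono φ ∧
        ∀ t : E, Tendsto (fun j => partialSum (φ j) ⇑f t) atTop (𝓝 (h t))} ∈
      residual (Lp ℂ p (@AddCircle.haarAddCircle (2 * Real.pi) _)) := by
  have : Countable E := hE.to_subtype
  set μ := (@AddCircle.haarAddCircle (2 * Real.pi) _) with hμ
  let Φ : ℕ → Lp ℂ p μ → (E → ℂ) := fun n f t => partialSum n ⇑f t
  have hΦ : ∀ n, Continuous (Φ n) := fun n => continuous_pi fun t => partialSum_cont p n t
  have key : ∀ U ∈ countableBasis (E → ℂ), ∀ N : ℕ,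
      {f : Lp ℂ p μ | ∃ n ≥ N, Φ n f ∈ U} ∈ residual (Lp ℂ p μ) := by
    intro U hU N
    have hUo := isOpen_of_mem_countableBasis hU
    apply residual_of_dense_open
    · have : {f : Lp ℂ p μ | ∃ n ≥ N, Φ n f ∈ U} = ⋃ n ≥ N, Φ n ⁻¹' U := by
        ext f; simp
      rw [this]
      exact isOpen_biUnion fun n _ => hUo.preimage (hΦ n)
    · rw [dense_iff_inter_open]
      intro W hW hWne
      have hT : Dense (Submodule.span ℂ (range (@fourier (2 * Real.pi))) : Set C(UnitCircle, ℂ)) :=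
        Submodule.dense_iff_topologicalClosure_eq_top.2 span_fourier_closure_eq_top
      have hd := (dense_pair E p hp').dense_image (by
        refine (ContinuousLinearMap.continuous _).prodMk (continuous_pi fun t => ?_)
        exact continuous_eval_const (t : UnitCircle)) hT
      obtain ⟨_, ⟨hxW, hxU⟩, P, hP, rfl⟩ := hd.inter_open_nonempty (W ×ˢ U) (hW.prod hUo)
        (hWne.prod (nonempty_of_mem_countableBasis hU))
      obtain ⟨M, hM⟩ := partialSum_trig P hP
      refine ⟨_, hxW, max N M, le_max_left _ _, ?_⟩
      convert hxU using 1
      ext t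
      have h1 := hM (max N M) (le_max_right _ _)
      simp only [Φ]
      conv_rhs => rw [← h1]
      simp only [partialSum]
      rw [fourierCoeff_congr_ae (ContinuousMap.coeFn_toLp μ P)]
  have key2 : (⋂ U ∈ countableBasis (E → ℂ), ⋂ N : ℕ,
      {f : Lp ℂ p μ | ∃ n ≥ N, Φ n f ∈ U}) ∈ residual (Lp ℂ p μ) :=
    (countable_bInter_mem (countable_countableBasis _)).2 fun U hU =>
      countable_iInter_mem.2 fun N => key U hU N
  filter_upwards [key2] with f hf h
  simp only [mem_iInter, mem_ofPred_eq] at hf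
  have hc : MapClusterPt h atTop (fun n => Φ n f) := by
    rw [((isBasis_countableBasis (E → ℂ)).nhds_hasBasis).mapClusterPt_iff_frequently]
    rintro U ⟨hU, -⟩
    exact frequently_atTop.2 fun N => hf U hU N
  obtain ⟨φ, hφ, hlim⟩ := hc.tendsto_subseq
  exact ⟨φ, hφ, fun t => (tendsto_pi_nhds.1 hlim) t⟩
end
end

section
/- For every compact set E₀ ⊆ 𝕋, quasi all f ∈ C(𝕋) have the property that for quasi all E ∈ 𝒦(E₀) (nonempty compact subsets of E₀ with the Hausdorff metric), the set {sₙf|_E : n ∈ ℕ} is dense in C(E), provided E₀ is infinite (so that 𝒦(E₀) is a perfect complete metric space). -/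
open MeasureTheory Complex Filter Topology Set TopologicalSpace

noncomputable section

lemma abel_step (z : ℂ) (hz : ‖z‖ = 1) (m j : ℕ) :
    ‖(1 - z) * ∑ k ∈ Finset.Ioc m (m + 1 + j), z ^ k / (k : ℂ) +
      z ^ (m + 1 + j + 1) / ((m + 1 + j : ℕ) : ℂ)‖ ≤ 2 / ((m : ℝ) + 1) - 1 / ((m + 1 + j : ℕ) : ℝ) := by
  induction j with
  | zero =>
    have h0 : ((m : ℂ) + 1) ≠ 0 := by exact_mod_cast (Nat.succ_ne_zero m)
    have : (1 - z) * ∑ k ∈ Finset.Ioc m (m + 1 + 0), z ^ k / (k : ℂ) +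
      z ^ (m + 1 + 0 + 1) / ((m + 1 + 0 : ℕ) : ℂ) = z ^ (m + 1) / ((m + 1 : ℕ) : ℂ) := by
      rw [add_zero, Finset.sum_Ioc_succ_top (by omega)]
      simp; field_simp; ring
    rw [this, norm_div, norm_pow, hz, Complex.norm_natCast]
    push_cast
    rw [add_zero, ← sub_div]
    norm_num
  | succ j ih =>
    have h0 : (((m + 1 + j : ℕ) : ℂ)) ≠ 0 := Nat.cast_ne_zero.mpr (by omega)
    have h1 : (((m + 1 + j : ℕ) : ℂ) + 1) ≠ 0 := Nat.cast_add_one_ne_zero _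
    have e : (1 - z) * ∑ k ∈ Finset.Ioc m (m + 1 + (j + 1)), z ^ k / (k : ℂ) +
      z ^ (m + 1 + (j + 1) + 1) / ((m + 1 + (j + 1) : ℕ) : ℂ) =
      ((1 - z) * ∑ k ∈ Finset.Ioc m (m + 1 + j), z ^ k / (k : ℂ) +
      z ^ (m + 1 + j + 1) / ((m + 1 + j : ℕ) : ℂ)) -
        z ^ (m + 1 + j + 1) * (((1 / ((m + 1 + j : ℕ) : ℝ) - 1 / (((m + 1 + j : ℕ) : ℝ) + 1) : ℝ)) : ℂ) := by
      rw [← add_assoc, Finset.sum_Ioc_succ_top (by omega)]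
      generalize m + 1 + j = q at *
      push_cast
      field_simp; ring
    rw [e]
    refine (norm_sub_le _ _).trans ?_
    rw [norm_mul, norm_pow, hz, one_pow, one_mul, Complex.norm_real, Real.norm_of_nonneg]
    · have : ((m + 1 + (j + 1) : ℕ) : ℝ) = ((m + 1 + j : ℕ) : ℝ) + 1 := by push_cast; ring
      rw [this]; linarith
    · rw [sub_nonneg]
      apply one_div_le_one_div_of_le <;> norm_cast <;> omega

lemma abel_bound (z : ℂ) (hz : ‖z‖ = 1) (m N : ℕ) :
    ‖1 - z‖ * ‖∑ k ∈ Finset.Ioc m N, z ^ k / (k : ℂ)‖ ≤ 2 / ((m : ℝ) + 1) := by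
  rcases le_or_gt N m with h | h
  · rw [Finset.Ioc_eq_empty (by omega)]; simp; positivity
  · obtain ⟨j, rfl⟩ := Nat.exists_eq_add_of_le (Nat.succ_le_of_lt h)
    have := abel_step z hz m j
    rw [← norm_mul]
    set A := (1 - z) * ∑ k ∈ Finset.Ioc m (m + 1 + j), z ^ k / (k : ℂ) with hA
    change ‖A‖ ≤ _
    set B := z ^ (m + 1 + j + 1) / ((m + 1 + j : ℕ) : ℂ) with hB
    have h2 : ‖B‖ = 1 / ((m + 1 + j : ℕ) : ℝ) := by
      rw [hB, norm_div, norm_pow, hz, one_pow, Complex.norm_natCast]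
    calc ‖A‖ = ‖(A + B) - B‖ := by ring_nf
      _ ≤ ‖A + B‖ + ‖B‖ := norm_sub_le _ _
      _ ≤ _ := by linarith

lemma pow_sub_inv (z : ℂ) (hz : ‖z‖ = 1) (k : ℕ) : ‖z ^ k - z⁻¹ ^ k‖ ≤ k * (2 * ‖1 - z‖) := by
  have hz0 : z ≠ 0 := by rintro rfl; simp at hz
  have h : z ^ k - z⁻¹ ^ k = (z - z⁻¹) * ∑ i ∈ Finset.range k, z ^ i * z⁻¹ ^ (k - 1 - i) :=
    ((Commute.all _ _).mul_geom_sum₂ k).symm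
  rw [h, norm_mul, mul_comm]
  gcongr
  · refine (norm_sum_le _ _).trans ?_
    simp [hz]
  · have : z - z⁻¹ = -((1 - z) * (1 + z⁻¹)) := by field_simp; ring
    rw [this, norm_neg, norm_mul, mul_comm]
    gcongr
    refine (norm_add_le _ _).trans ?_
    simp [hz]; norm_num

lemma sine_bound (z : ℂ) (hz : ‖z‖ = 1) (N : ℕ) :
    ‖∑ k ∈ Finset.Ioc 0 N, (z ^ k - z⁻¹ ^ k) / (k : ℂ)‖ ≤ 6 := by
  have hz0 : z ≠ 0 := by rintro rfl; simp at hz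
  set d := ‖1 - z‖ with hd
  rcases (norm_nonneg (1 - z)).eq_or_lt with h0 | h0
  · have : z = 1 := by
      have := norm_eq_zero.mp h0.symm
      linear_combination -this
    simp [this]
  rw [← hd] at h0
  set m := ⌊1 / d⌋₊ with hm
  have hm1 : (m : ℝ) * d ≤ 1 := by
    have := Nat.floor_le (show 0 ≤ 1 / d by positivity)
    rwa [← hm, le_div_iff₀ h0] at this
  have hm2 : 1 ≤ ((m : ℝ) + 1) * d := by
    have := (Nat.lt_floor_add_one (1 / d)).le
    rwa [← hm, div_le_iff₀ h0] at this
  have head : ∀ M : ℕ, M ≤ m →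
      ‖∑ k ∈ Finset.Ioc 0 M, (z ^ k - z⁻¹ ^ k) / (k : ℂ)‖ ≤ 2 := by
    intro M hM
    calc _ ≤ ∑ k ∈ Finset.Ioc 0 M, (2 * d) := by
          refine norm_sum_le_of_le _ fun k hk => ?_
          rw [Finset.mem_Ioc] at hk
          have hk' : (0 : ℝ) < k := by exact_mod_cast hk.1
          rw [norm_div, Complex.norm_natCast, div_le_iff₀ hk', mul_comm]
          exact pow_sub_inv z hz k
      _ = M * d * 2 := by simp; ring
      _ ≤ m * d * 2 := by gcongr
      _ ≤ 2 := by linarith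
  rcases le_or_gt N m with h | h
  · linarith [head N h]
  rw [← Finset.sum_Ioc_consecutive _ (Nat.zero_le m) h.le]
  have hinv : ‖1 - z⁻¹‖ = d := by
    have : 1 - z⁻¹ = -((1 - z) * z⁻¹) := by field_simp; ring
    rw [this, norm_neg, norm_mul, norm_inv, hz]; simp [hd]
  have tail : ∀ w : ℂ, ‖w‖ = 1 → ‖1 - w‖ = d → ‖∑ k ∈ Finset.Ioc m N, w ^ k / (k : ℂ)‖ ≤ 2 := by
    intro w hw hwd
    have := abel_bound w hw m N
    rw [hwd, le_div_iff₀ (by positivity)] at this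
    nlinarith [norm_nonneg (∑ k ∈ Finset.Ioc m N, w ^ k / (k : ℂ))]
  have e : ∑ k ∈ Finset.Ioc m N, (z ^ k - z⁻¹ ^ k) / (k : ℂ) =
    ∑ k ∈ Finset.Ioc m N, z ^ k / (k : ℂ) - ∑ k ∈ Finset.Ioc m N, z⁻¹ ^ k / (k : ℂ) := by
    rw [← Finset.sum_sub_distrib]; simp only [sub_div]
  rw [e]
  have h1 := tail z hz rfl
  have h2 := tail z⁻¹ (by simp [hz]) hinv
  have h3 := head m le_rfl
  refine (norm_add_le _ _).trans ?_
  linarith [norm_sub_le (∑ k ∈ Finset.Ioc m N, z ^ k / (k : ℂ)) (∑ k ∈ Finset.Ioc m N, z⁻¹ ^ k / (k : ℂ))]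

/-- Partial sum as a linear map. -/
def PS (n : ℕ) : C(UnitCircle, ℂ) →ₗ[ℂ] C(UnitCircle, ℂ) where
  toFun f := partialSum n f
  map_add' f g := by
    have hi : ∀ f : C(UnitCircle, ℂ), Integrable f (AddCircle.haarAddCircle (T := 2 * Real.pi)) :=
      fun f => f.continuous.integrable_of_hasCompactSupport (HasCompactSupport.of_compactSpace _)
    simp only [partialSum, ContinuousMap.coe_add, fourierCoeff.add (hi f) (hi g), Pi.add_apply, add_smul,
      Finset.sum_add_distrib]
  map_smul' c f := by
    simp only [partialSum, ContinuousMap.coe_smul, fourierCoeff.const_smul, smul_assoc, Finset.smul_sum,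
      RingHom.id_apply]

lemma PS_apply (n : ℕ) (f : C(UnitCircle, ℂ)) : PS n f = partialSum n f := rfl

lemma PS_fourier (n : ℕ) (j : ℤ) :
    PS n (fourier j) = if |j| ≤ n then fourier j else 0 := by
  rw [PS_apply, partialSum, fourierCoeff_fourier]
  simp only [Pi.single_apply, ite_smul, one_smul, zero_smul, Finset.sum_ite_eq', Finset.mem_Icc, abs_le]

lemma PS_cont (n : ℕ) (x : UnitCircle) :
    Continuous fun f : C(UnitCircle, ℂ) => PS n f x := by
  have hc : ∀ k : ℤ, Continuous fun f : C(UnitCircle, ℂ) => fourierCoeff f k := by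
    intro k
    have : (fun f : C(UnitCircle, ℂ) => fourierCoeff f k) = fun f =>
        inner ℂ ((fourierBasis (T := 2 * Real.pi)) k)
          (ContinuousMap.toLp 2 AddCircle.haarAddCircle ℂ f) := by
      ext f
      rw [← HilbertBasis.repr_apply_apply, fourierBasis_repr, fourierCoeff_toLp]
    rw [this]
    fun_prop
  simp only [PS_apply, partialSum, ContinuousMap.sum_apply, ContinuousMap.smul_apply]
  exact continuous_finsetSum _ fun k _ => (hc k).smul continuous_const

lemma PS_eventually (p : C(UnitCircle, ℂ))
    (hp : p ∈ Submodule.span ℂ (range <| @fourier (2 * Real.pi))) :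
    ∀ᶠ n in atTop, PS n p = p := by
  induction hp using Submodule.span_induction with
  | mem x h =>
    obtain ⟨j, rfl⟩ := h
    filter_upwards [eventually_ge_atTop j.natAbs] with n hn
    rw [PS_fourier, if_pos (by rw [abs_le]; omega)]
  | zero => simp
  | add x y _ _ hx hy => filter_upwards [hx, hy] with n h1 h2; rw [map_add, h1, h2]
  | smul a x _ hx => filter_upwards [hx] with n h1; rw [map_smul, h1]

/-- Translated Fejér polynomial. -/
def peak (N : ℕ) (x : UnitCircle) : C(UnitCircle, ℂ) :=
  ∑ k ∈ Finset.Ioc 0 N, (1 / (k : ℂ)) • (fourier ((N : ℤ) + k) (-x) • fourier ((N : ℤ) + k) -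
    fourier ((N : ℤ) - k) (-x) • fourier ((N : ℤ) - k))

lemma fourier_trans (j : ℤ) (x y : UnitCircle) :
    fourier j (-x) * fourier j y = (fourier 1 (y - x)) ^ j := by
  simp only [fourier_apply, one_zsmul, ← Circle.coe_mul, ← AddCircle.toCircle_add, ← Circle.coe_zpow,
    ← AddCircle.toCircle_zsmul]
  congr 2
  rw [← zsmul_add]; congr 1; abel

lemma norm_fourier_apply (j : ℤ) (x : UnitCircle) : ‖fourier j x‖ = 1 := by
  rw [fourier_apply, Circle.norm_coe]

lemma peak_norm (N : ℕ) (x : UnitCircle) : ‖peak N x‖ ≤ 6 := by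
  rw [ContinuousMap.norm_le _ (by norm_num)]
  intro y
  set z := fourier 1 (y - x) with hz
  have hz1 : ‖z‖ = 1 := norm_fourier_apply _ _
  have hz0 : z ≠ 0 := by intro h; rw [h] at hz1; simp at hz1
  have : peak N x y = z ^ N * ∑ k ∈ Finset.Ioc 0 N, (z ^ k - z⁻¹ ^ k) / (k : ℂ) := by
    rw [peak, ContinuousMap.sum_apply, Finset.mul_sum]
    refine Finset.sum_congr rfl fun k hk => ?_
    simp only [ContinuousMap.smul_apply, ContinuousMap.sub_apply, smul_eq_mul, fourier_trans, ← hz]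
    rw [zpow_add₀ hz0, zpow_sub₀ hz0]
    simp only [zpow_natCast, inv_pow]
    ring
  rw [this, norm_mul, norm_pow, hz1, one_pow, one_mul]
  exact sine_bound z hz1 N

lemma peak_PS (N : ℕ) (x y : UnitCircle) :
    PS N (peak N x) y = - ((fourier 1 (y - x)) ^ N *
      ∑ k ∈ Finset.Ioc 0 N, (fourier 1 (y - x))⁻¹ ^ k / (k : ℂ)) := by
  set z := fourier 1 (y - x) with hz
  have hz1 : ‖z‖ = 1 := norm_fourier_apply _ _
  have hz0 : z ≠ 0 := by intro h; rw [h] at hz1; simp at hz1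
  rw [peak, map_sum, ContinuousMap.sum_apply, Finset.mul_sum, ← Finset.sum_neg_distrib]
  refine Finset.sum_congr rfl fun k hk => ?_
  rw [Finset.mem_Ioc] at hk
  rw [map_smul, map_sub, map_smul, map_smul, PS_fourier, PS_fourier, if_neg, if_pos]
  · simp only [ContinuousMap.smul_apply, ContinuousMap.sub_apply, smul_eq_mul, fourier_trans, ← hz,
      smul_zero, ContinuousMap.zero_apply]
    rw [zpow_sub₀ hz0]
    simp only [zpow_natCast, inv_pow]
    ring
  · rw [abs_le]; omega
  · rw [abs_le]; omega

/-- Harmonic sum. -/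
def harm (N : ℕ) : ℝ := ∑ k ∈ Finset.Ioc 0 N, 1 / (k : ℝ)

lemma harm_tendsto : Tendsto harm atTop atTop := by
  have := Real.tendsto_sum_range_one_div_nat_succ_atTop
  refine this.congr fun n => ?_
  induction n with
  | zero => simp [harm]
  | succ n ih =>
    rw [Finset.sum_range_succ, ih, harm, harm, Finset.sum_Ioc_succ_top (by omega)]; simp

lemma peak_PS_self (N : ℕ) (x : UnitCircle) : PS N (peak N x) x = - (harm N : ℂ) := by
  rw [peak_PS, sub_self]; simp [harm]

lemma peak_PS_ne (x y : UnitCircle) (h : y ≠ x) :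
    ∃ C : ℝ, 0 ≤ C ∧ ∀ N, ‖PS N (peak N x) y‖ ≤ C := by
  set z := fourier 1 (y - x) with hz
  have hz1 : ‖z‖ = 1 := norm_fourier_apply _ _
  have hne : z⁻¹ ≠ 1 := by
    intro h1
    rw [inv_eq_one, hz, fourier_one, Circle.coe_eq_one] at h1
    rw [← AddCircle.toCircle_zero (T := 2 * Real.pi)] at h1
    have := AddCircle.injective_toCircle (T := 2 * Real.pi) (by positivity) h1
    exact h (sub_eq_zero.mp this)
  have hd : 0 < ‖1 - z⁻¹‖ := norm_pos_iff.mpr (sub_ne_zero.mpr hne.symm)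
  refine ⟨2 / ‖1 - z⁻¹‖, by positivity, fun N => ?_⟩
  have := abel_bound z⁻¹ (by simp [hz1]) 0 N
  rw [peak_PS, norm_neg, norm_mul, norm_pow, ← hz, hz1, one_pow, one_mul, le_div_iff₀ hd, mul_comm]
  simpa using this

lemma peak_small (x y : UnitCircle) (b : ℂ) :
    Tendsto (fun N => PS N (peak N x) y * (b / (harm N : ℂ))) atTop
      (𝓝 (if y = x then -b else 0)) := by
  have hb : Tendsto (fun N => b / (harm N : ℂ)) atTop (𝓝 0) := by
    rw [tendsto_zero_iff_norm_tendsto_zero]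
    simp only [norm_div, Complex.norm_real]
    exact tendsto_const_nhds.div_atTop (tendsto_norm_atTop_atTop.comp harm_tendsto)
  split_ifs with h
  · subst h
    refine tendsto_const_nhds.congr' ?_
    filter_upwards [harm_tendsto.eventually_gt_atTop 0] with N hN
    rw [peak_PS_self]
    have : (harm N : ℂ) ≠ 0 := by exact_mod_cast hN.ne'
    field_simp
  · obtain ⟨C, hC, hN⟩ := peak_PS_ne x y h
    rw [tendsto_zero_iff_norm_tendsto_zero] at hb ⊢
    refine squeeze_zero (fun _ => norm_nonneg _) (fun N => ?_) (by simpa only [mul_zero] using hb.const_mul C)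
    rw [norm_mul]
    gcongr
    exact hN N

lemma dense_fin (F : Finset UnitCircle) (c : UnitCircle → ℂ) (ε : ℝ) (hε : 0 < ε) :
    {f : C(UnitCircle, ℂ) | ∃ n, ∀ y ∈ F, ‖PS n f y - c y‖ < ε} ∈ residual C(UnitCircle, ℂ) := by
  classical
  refine residual_of_dense_open ?_ ?_
  · have : {f : C(UnitCircle, ℂ) | ∃ n, ∀ y ∈ F, ‖PS n f y - c y‖ < ε} =
        ⋃ n, ⋂ y ∈ F, {f : C(UnitCircle, ℂ) | ‖PS n f y - c y‖ < ε} := by ext; simp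
    rw [this]
    refine isOpen_iUnion fun n => isOpen_biInter_finset fun y _ => ?_
    exact isOpen_lt ((PS_cont n y).sub continuous_const).norm continuous_const
  · have hd : Dense (Submodule.span ℂ (range <| @fourier (2 * Real.pi)) : Set C(UnitCircle, ℂ)) :=
      (Submodule.dense_iff_topologicalClosure_eq_top).mpr span_fourier_closure_eq_top
    rw [← dense_closure]
    refine hd.mono fun p hp => ?_
    let g : ℕ → C(UnitCircle, ℂ) := fun N =>
      p + ∑ x ∈ F, (((p x - c x) / (harm N : ℂ)) • peak N x)
    have hg : Tendsto g atTop (𝓝 p) := by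
      have : Tendsto g atTop (𝓝 (p + ∑ x ∈ F, 0)) := by
        refine tendsto_const_nhds.add (tendsto_finsetSum _ fun x _ => ?_)
        have hb : Tendsto (fun N => ‖p x - c x‖ / ‖harm N‖ * 6) atTop (𝓝 (0 * 6)) :=
          (tendsto_const_nhds.div_atTop (tendsto_norm_atTop_atTop.comp harm_tendsto)).mul_const _
        rw [zero_mul] at hb
        refine squeeze_zero_norm (fun N => ?_) hb
        rw [norm_smul, norm_div, Complex.norm_real]
        gcongr
        exact peak_norm N x
      simpa using this
    refine mem_closure_of_tendsto hg ?_
    have hval : ∀ y ∈ F, Tendsto (fun N => PS N (g N) y) atTop (𝓝 (c y)) := by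
      intro y hy
      have h1 : Tendsto (fun N => p y + ∑ x ∈ F, PS N (peak N x) y * ((p x - c x) / (harm N : ℂ)))
          atTop (𝓝 (p y + ∑ x ∈ F, if y = x then -(p x - c x) else 0)) :=
        tendsto_const_nhds.add (tendsto_finsetSum _ fun x _ => peak_small x y _)
      have h2 : p y + (∑ x ∈ F, if y = x then -(p x - c x) else 0) = c y := by
        rw [Finset.sum_ite_eq, if_pos hy]; ring
      rw [h2] at h1
      refine h1.congr' ?_
      filter_upwards [PS_eventually p hp] with N hN
      simp only [g, map_add, map_sum, map_smul, hN, ContinuousMap.add_apply, ContinuousMap.sum_apply,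
        ContinuousMap.smul_apply, smul_eq_mul, mul_comm]
    have : ∀ᶠ N in atTop, ∀ y ∈ F, ‖PS N (g N) y - c y‖ < ε := by
      rw [Finset.eventually_all]
      intro y hy
      have := (Metric.tendsto_nhds.mp (hval y hy)) ε hε
      simpa only [dist_eq_norm] using this
    filter_upwards [this] with N hN
    exact ⟨N, hN⟩

/-- Localized version: for every infinite compact `E₀ ⊆ 𝕋`, quasi all `f ∈ C(𝕋)` are such
that for quasi all nonempty compact `E ⊆ E₀`, the set `{sₙ f |_E : n ∈ ℕ}` is dense in
`C(E)`. -/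
theorem stmt18 (E₀ : Set UnitCircle) (hE₀ : IsCompact E₀) (hinf : E₀.Infinite) :
    {f : C(UnitCircle, ℂ) |
      {E : NonemptyCompacts E₀ |
        Dense (Set.range fun n =>
          ((partialSum n ⇑f).restrict E₀).restrict (E : Set E₀))} ∈
        residual (NonemptyCompacts E₀)} ∈ residual C(UnitCircle, ℂ) := by
  have : CompactSpace E₀ := isCompact_iff_compactSpace.mp hE₀
  obtain ⟨T, hTfin, hTc, hTd⟩ :=
    (NonemptyCompacts.dense_setOfPred_finite (α := E₀)).exists_countable_dense_subset
  obtain ⟨G, hGc, hGd⟩ := exists_countable_dense C(UnitCircle, ℂ)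
  have key : ∀ᶠ f in residual C(UnitCircle, ℂ), ∀ F ∈ T, ∀ g ∈ G, ∀ m : ℕ,
      ∃ n, ∀ y : E₀, y ∈ F → ‖PS n f y - g y‖ < 1 / ((m : ℝ) + 1) := by
    rw [eventually_countable_ball hTc]
    intro F hF
    rw [eventually_countable_ball hGc]
    intro g hg
    rw [eventually_countable_forall]
    intro m
    have hfin : (Subtype.val '' (F : Set E₀)).Finite := (hTfin hF).image _
    filter_upwards [dense_fin hfin.toFinset g (1 / ((m : ℝ) + 1)) (by positivity)] with f hf
    obtain ⟨n, hn⟩ := hf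
    exact ⟨n, fun y hy => hn y (by simpa using hy)⟩
  filter_upwards [key] with f hf
  have key2 : ∀ᶠ E : NonemptyCompacts E₀ in residual (NonemptyCompacts E₀), ∀ g ∈ G, ∀ m : ℕ,
      ∃ n, ∀ y : E₀, y ∈ E → ‖PS n f y - g y‖ < 1 / ((m : ℝ) + 1) := by
    rw [eventually_countable_ball hGc]
    intro g hg
    rw [eventually_countable_forall]
    intro m
    refine residual_of_dense_open ?_ (hTd.mono fun F hF => hf F hF g hg m)
    have : {E : NonemptyCompacts E₀ | ∃ n, ∀ y : E₀, y ∈ E → ‖PS n f y - g y‖ < 1 / ((m : ℝ) + 1)} =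
        ⋃ n, {E : NonemptyCompacts E₀ |
          (E : Set E₀) ⊆ {y : E₀ | ‖PS n f y - g y‖ < 1 / ((m : ℝ) + 1)}} := by
      ext E; simp [Set.subset_def]
    refine this ▸ isOpen_iUnion fun n => NonemptyCompacts.isOpen_subsets_of_isOpen ?_
    exact isOpen_lt (by fun_prop) continuous_const
  filter_upwards [key2] with E hE
  have : CompactSpace (E : Set E₀) := isCompact_iff_compactSpace.mp E.isCompact
  rw [Metric.dense_iff]
  intro φ r hr
  obtain ⟨ψ, hψ⟩ := φ.exists_restrict_eq E.isCompact.isClosed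
  obtain ⟨χ, hχ⟩ := ψ.exists_restrict_eq hE₀.isClosed
  obtain ⟨g, hg, hgχ⟩ := hGd.exists_dist_lt χ (half_pos hr)
  obtain ⟨m, hm⟩ := exists_nat_one_div_lt (half_pos hr)
  obtain ⟨n, hn⟩ := hE g hg m
  refine ⟨_, ?_, ⟨n, rfl⟩⟩
  rw [Metric.mem_ball, ContinuousMap.dist_lt_iff hr]
  intro y
  have h1 : φ y = χ y := by rw [← hψ, ← hχ]; rfl
  rw [h1]
  have h2 := hn y y.2
  have h3 : dist (χ y) (g y) < r / 2 := (ContinuousMap.dist_apply_le_dist _).trans_lt hgχ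
  have h4 : dist (PS n f y) (g y) < r / 2 := by rw [dist_eq_norm]; exact h2.trans hm
  calc dist (PS n f y) (χ y) ≤ dist (PS n f y) (g y) + dist (χ y) (g y) := dist_triangle_right _ _ _
    _ < r := by linarith
end
end
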